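/- Let w ∈ S_n, I ⊆ J(w), and D = [n−1] ∖ I. Then w_0(I)·w is a standard Coxeter element of some parabolic subgroup of S_n if and only if for every partition λ = (λ_1 ≥ … ≥ λ_n ≥ 0), the key polynomial κ_{wλ} is D-multiplicity-free, i.e., in the (unique) expansion of κ_{wλ} in the D-Schur polynomial basis of the ring Π_D of D-split-symmetric polynomials, every coefficient is 0 or 1. (For any I ⊆ J(w) and any such λ, κ_{wλ} lies in Π_D.) -/

import Mathlib

open scoped Classical

namespace LSS

noncomputable section

open MvPolynomial

/-- The simple transposition `s_i ∈ S_n` (`1 ≤ i ≤ n-1`, 1-indexed): it exchanges the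
letters `i` and `i+1` of `[n] = {1, …, n}`, realized on `Fin n` (0-indexed) as the swap
of `i-1` and `i`. For `i` out of range it is the identity. -/
def st (n : ℕ) (i : ℕ) : Equiv.Perm (Fin n) :=
  if h : 0 < i ∧ i < n then Equiv.swap ⟨i - 1, by omega⟩ ⟨i, h.2⟩ else 1

/-- Coxeter length of `w ∈ S_n` = number of inversions. -/
def len (n : ℕ) (w : Equiv.Perm (Fin n)) : ℕ :=
  (Finset.univ.filter fun p : Fin n × Fin n => p.1 < p.2 ∧ w p.2 < w p.1).card

/-- `L` is a reduced word for `w`: a list of indices in `[n-1]` of length `ℓ(w)` whose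
associated product of simple transpositions is `w`. -/
def IsRedWord (n : ℕ) (L : List ℕ) (w : Equiv.Perm (Fin n)) : Prop :=
  (∀ i ∈ L, 1 ≤ i ∧ i ≤ n - 1) ∧ (L.map (st n)).prod = w ∧ L.length = len n w

/-- The left descent set `J(w) = {j ∈ [n-1] : ℓ(s_j w) < ℓ(w)}`. -/
def Descents (n : ℕ) (w : Equiv.Perm (Fin n)) : Set ℕ :=
  {j | 1 ≤ j ∧ j ≤ n - 1 ∧ len n (st n j * w) < len n w}

/-- The parabolic subgroup of `S_n` generated by `{s_i : i ∈ I}`. -/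
def parab (n : ℕ) (I : Set ℕ) : Subgroup (Equiv.Perm (Fin n)) :=
  Subgroup.closure (st n '' I)

/-- `u = w_0(I)`, the longest element of the parabolic subgroup generated by `{s_i : i ∈ I}`. -/
def IsLongest (n : ℕ) (I : Set ℕ) (u : Equiv.Perm (Fin n)) : Prop :=
  u ∈ parab n I ∧ ∀ v ∈ parab n I, len n v ≤ len n u

/-- `c` is a standard Coxeter element of some parabolic subgroup of `S_n`: a product of
the elements of some subset of `{s_1, …, s_{n-1}}`, each appearing exactly once, in some order. -/
def IsStdCox (n : ℕ) (c : Equiv.Perm (Fin n)) : Prop :=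
  ∃ L : List ℕ, L.Nodup ∧ (∀ i ∈ L, 1 ≤ i ∧ i ≤ n - 1) ∧ (L.map (st n)).prod = c

/-- A weak composition `β : Fin n → ℕ` as an exponent vector. -/
def expOf (n : ℕ) (β : Fin n → ℕ) : Fin n →₀ ℕ := Finsupp.equivFunOnFinite.symm β

/-- The monomial `x^β = x_1^{β_1} ⋯ x_n^{β_n}`. -/
def mono (n : ℕ) (β : Fin n → ℕ) : MvPolynomial (Fin n) ℤ := monomial (expOf n β) 1

/-- The coefficient `[x^β] f`. -/
def coeffOf (n : ℕ) (β : Fin n → ℕ) (f : MvPolynomial (Fin n) ℤ) : ℤ := coeff (expOf n β) f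

/-- The isobaric divided difference (Demazure) operator
`π_i(f) = (x_i f − x_{i+1} s_i f)/(x_i − x_{i+1})` (1-indexed `i`), defined as the unique
polynomial `g` with `(x_i − x_{i+1})·g = x_i f − x_{i+1} s_i f`; such a `g` always exists
and is unique since `ℤ[x_1,…,x_n]` is a domain. -/
def dem (n : ℕ) (i : ℕ) (f : MvPolynomial (Fin n) ℤ) : MvPolynomial (Fin n) ℤ :=
  if h : 0 < i ∧ i < n then
    if hg : ∃ g, (X (⟨i - 1, by omega⟩ : Fin n) - X (⟨i, h.2⟩ : Fin n)) * g =
        X (⟨i - 1, by omega⟩ : Fin n) * f -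
          X (⟨i, h.2⟩ : Fin n) *
            rename (⇑(Equiv.swap (⟨i - 1, by omega⟩ : Fin n) (⟨i, h.2⟩ : Fin n))) f then
      hg.choose
    else 0
  else f

/-- `π_{i_1} π_{i_2} ⋯ π_{i_ℓ} (f)` for a word `L = [i_1, …, i_ℓ]`. -/
def demWord (n : ℕ) (L : List ℕ) (f : MvPolynomial (Fin n) ℤ) : MvPolynomial (Fin n) ℤ :=
  L.foldr (dem n) f

/-- Entry accessor for a composition, 0-indexed position, default `0` out of range. -/
def ent (n : ℕ) (α : Fin n → ℕ) (p : ℕ) : ℕ := if h : p < n then α ⟨p, h⟩ else 0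

/-- Exchange the entries of `α` in (0-indexed) positions `p` and `p+1`. -/
def swapAt (n : ℕ) (p : ℕ) (α : Fin n → ℕ) : Fin n → ℕ := fun m =>
  if (m : ℕ) = p then ent n α (p + 1) else if (m : ℕ) = p + 1 then ent n α p else α m

/-- Auxiliary fuelled recursion computing the key polynomial `κ_α`:
if `α` is weakly decreasing, `κ_α = x^α`; otherwise, choosing an ascent `α_p < α_{p+1}`
(0-indexed `p`), `κ_α = π_{p+1}(κ_{α̂})` where `α̂` swaps the two entries.  The fuel
`n*n` in `keyPoly` strictly exceeds the number of co-inversions, which drops by one at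
each step, so the recursion always terminates at a weakly decreasing composition. -/
def keyAux (n : ℕ) : ℕ → (Fin n → ℕ) → MvPolynomial (Fin n) ℤ
  | 0, α => mono n α
  | k + 1, α =>
    if h : ∃ p : Fin n, ent n α p.1 < ent n α (p.1 + 1) then
      dem n (h.choose.1 + 1) (keyAux n k (swapAt n h.choose.1 α))
    else mono n α

/-- The key polynomial `κ_α`. -/
def keyPoly (n : ℕ) (α : Fin n → ℕ) : MvPolynomial (Fin n) ℤ := keyAux n (n * n) α

/-- `wλ`, the composition `(λ_{w⁻¹(1)}, …, λ_{w⁻¹(n)})`. -/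
def pact (n : ℕ) (w : Equiv.Perm (Fin n)) (lam : Fin n → ℕ) : Fin n → ℕ :=
  fun i => lam (w⁻¹ i)

/-- `lam` is a partition (weakly decreasing vector) with at most `n` parts. -/
def IsPartition (n : ℕ) (lam : Fin n → ℕ) : Prop := ∀ i j : Fin n, i ≤ j → lam j ≤ lam i

/-- Box `(c, r)` (column, row; both 1-indexed) belongs to the skyline diagram `D(α)`. -/
def InDiag (n : ℕ) (α : Fin n → ℕ) (c r : ℕ) : Prop :=
  1 ≤ c ∧ c ≤ n ∧ 1 ≤ r ∧ r ≤ ent n α (c - 1)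

/-- `F` (value of box (column, row)) is a filling of `D(α)` that is flagged (labels in
column `c` are in `{1, …, c}`) and row distinct. -/
def IsTab (n : ℕ) (α : Fin n → ℕ) (F : ℕ → ℕ → ℕ) : Prop :=
  (∀ c r, InDiag n α c r → 1 ≤ F c r ∧ F c r ≤ c) ∧
  ∀ c c' r, InDiag n α c r → InDiag n α c' r → c ≠ c' → F c r ≠ F c' r

/-- The weight of a filling: `wt(F)_i` = number of occurrences of the label `i`
(1-indexed; `Fin` position `i` records the label `i+1`). -/
def wt (n : ℕ) (α : Fin n → ℕ) (F : ℕ → ℕ → ℕ) : Fin n → ℕ := fun i =>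
  ((Finset.Icc 1 n ×ˢ Finset.Icc 1 (Finset.univ.sup α)).filter fun p =>
    InDiag n α p.1 p.2 ∧ F p.1 p.2 = i.1 + 1).card

/-- `leftmin_α(i) = min{α_j : j ≤ i}`. -/
def leftmin (n : ℕ) (α : Fin n → ℕ) (i : Fin n) : ℕ := sInf (α '' {j | j ≤ i})

/-- `rightmax_α(i) = max{α_j : j ≥ i}`. -/
def rightmax (n : ℕ) (α : Fin n → ℕ) (i : Fin n) : ℕ :=
  Finset.sup (Finset.univ.filter fun j => i ≤ j) α

/-- `d` records `0 = d_0 < d_1 < ⋯ < d_k < d_{k+1} = n`. -/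
def BlockData (n k : ℕ) (d : Fin (k + 2) → ℕ) : Prop :=
  d 0 = 0 ∧ d (Fin.last (k + 1)) = n ∧ StrictMono d

/-- `D = {d_1, …, d_k}` as a set of natural numbers. -/
def Dset (k : ℕ) (d : Fin (k + 2) → ℕ) : Set ℕ :=
  {m | ∃ t : Fin (k + 2), t ≠ 0 ∧ t ≠ Fin.last (k + 1) ∧ d t = m}

/-- `I = [n−1] ∖ D`. -/
def Iset (n k : ℕ) (d : Fin (k + 2) → ℕ) : Set ℕ :=
  {m | 1 ≤ m ∧ m ≤ n - 1 ∧ m ∉ Dset k d}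

/-- Positions `i, j` (of `Fin n`, 0-indexed; 1-indexed letters `i+1, j+1`) lie in the same
block: some `t` has `d_t < i+1, j+1 ≤ d_{t+1}`. -/
def SameBlock (n k : ℕ) (d : Fin (k + 2) → ℕ) (i j : Fin n) : Prop :=
  ∃ t : Fin (k + 1), d t.castSucc ≤ i.1 ∧ i.1 < d t.succ ∧ d t.castSucc ≤ j.1 ∧ j.1 < d t.succ

/-- The variables `X_t = {x_{d_t + 1}, …, x_{d_{t+1}}}` of the `t`-th block. -/
def blockVars (n k : ℕ) (d : Fin (k + 2) → ℕ) (t : Fin (k + 1)) : Finset (Fin n) :=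
  Finset.univ.filter fun p => d t.castSucc ≤ p.1 ∧ p.1 < d t.succ

/-- Complete homogeneous symmetric polynomial of degree `m` in the variables `S`. -/
def hPoly (n : ℕ) (S : Finset (Fin n)) (m : ℕ) : MvPolynomial (Fin n) ℤ :=
  ∑ f ∈ S.sym m, ((f : Multiset (Fin n)).map X).prod

/-- `h_z` for `z : ℤ`, with `h_z = 0` for `z < 0`. -/
def hZ (n : ℕ) (S : Finset (Fin n)) (z : ℤ) : MvPolynomial (Fin n) ℤ :=
  if 0 ≤ z then hPoly n S z.toNat else 0

/-- The Schur polynomial `s_lam` in the variable set `S`, for a partition `lam`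
(1-indexed parts, at most `t` of them), via the Jacobi–Trudi determinant
`det(h_{lam_i − i + j})_{1 ≤ i,j ≤ t}`. -/
def schurP (n : ℕ) (S : Finset (Fin n)) (t : ℕ) (lam : ℕ → ℕ) : MvPolynomial (Fin n) ℤ :=
  (Matrix.of fun i j : Fin t =>
    hZ n S ((lam (i.1 + 1) : ℤ) - (i.1 + 1) + (j.1 + 1))).det

/-- `γ ∈ Par_D`: a `(k+1)`-tuple of partitions, the `t`-th having at most
`d_{t+1} − d_t` nonzero parts (1-indexed parts; the unused index `0` is normalized to `0`). -/
def ParD (k : ℕ) (d : Fin (k + 2) → ℕ) (γ : Fin (k + 1) → ℕ → ℕ) : Prop :=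
  ∀ t : Fin (k + 1), γ t 0 = 0 ∧ (∀ a b : ℕ, 1 ≤ a → a ≤ b → γ t b ≤ γ t a) ∧
    ∀ m : ℕ, d t.succ - d t.castSucc < m → γ t m = 0

/-- The `D`-Schur polynomial `s_{γ^1,…,γ^{k+1}} = ∏_t s_{γ^t}(X_t)`. -/
def dSchur (n k : ℕ) (d : Fin (k + 2) → ℕ) (γ : Fin (k + 1) → ℕ → ℕ) :
    MvPolynomial (Fin n) ℤ :=
  ∏ t : Fin (k + 1), schurP n (blockVars n k d t) (d t.succ - d t.castSucc) (γ t)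

/-- Truncation of an integer vector to a natural-number vector. -/
def toNatV (n : ℕ) (β : Fin n → ℤ) : Fin n → ℕ := fun i => (β i).toNat

/-- `j − i` as an integer. -/
def gapZ (n : ℕ) (i j : Fin n) : ℤ := (j.1 : ℤ) - (i.1 : ℤ)

/-- The move `t_{ij}`: replace `β_i` by `β_j − (j−i)` and `β_j` by `β_i + (j−i)`. -/
def tmv (n : ℕ) (i j : Fin n) (β : Fin n → ℤ) : Fin n → ℤ := fun m =>
  if m = i then β j - gapZ n i j else if m = j then β i + gapZ n i j else β m

/-- The rank `θ(β) = #{(a,b) : a < b in the same block and β_a < β_b − (b−a)}`. -/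
def theta (n k : ℕ) (d : Fin (k + 2) → ℕ) (β : Fin n → ℤ) : ℕ :=
  (Finset.univ.filter fun p : Fin n × Fin n =>
    p.1 < p.2 ∧ SameBlock n k d p.1 p.2 ∧ β p.1 < β p.2 - gapZ n p.1 p.2).card

/-- One step up in the Bruhat-type order: `β ⋖ t_{ij} β` whenever `i < j` are in the same
block and `β_i > β_j − (j−i)`. -/
def stepUp (n k : ℕ) (d : Fin (k + 2) → ℕ) (β β' : Fin n → ℤ) : Prop :=
  ∃ i j : Fin n, i < j ∧ SameBlock n k d i j ∧ β j - gapZ n i j < β i ∧ β' = tmv n i j β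

/-- The order on compositions: transitive (reflexive) closure of `stepUp`. -/
def leB (n k : ℕ) (d : Fin (k + 2) → ℕ) : (Fin n → ℤ) → (Fin n → ℤ) → Prop :=
  Relation.ReflTransGen (stepUp n k d)

/-- Membership in the poset `P_{α,γ}` (for `α = cλ`): `β` is a weak composition with
`[x^β] κ_α ≠ 0` and `π_{w_0(I)}(x^β) = ± s_γ`. -/
def memP (n k : ℕ) (d : Fin (k + 2) → ℕ) (w0I : Equiv.Perm (Fin n)) (α : Fin n → ℕ)
    (γ : Fin (k + 1) → ℕ → ℕ) (β : Fin n → ℤ) : Prop :=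
  (∀ i, 0 ≤ β i) ∧ coeffOf n (toNatV n β) (keyPoly n α) ≠ 0 ∧
  ∃ L, IsRedWord n L w0I ∧
    (demWord n L (mono n (toNatV n β)) = dSchur n k d γ ∨
     demWord n L (mono n (toNatV n β)) = -dSchur n k d γ)

/-- The pair `i < j` is interweaved for `α`: `α_m ≥ α_{m+1}` for `i ≤ m < j`,
`leftmin_α(i) < α_i` and `rightmax_α(j) > α_j`. -/
def Interweaved (n : ℕ) (α : Fin n → ℕ) (i j : Fin n) : Prop :=
  i < j ∧ (∀ p : Fin n, i ≤ p → p < j → ent n α (p.1 + 1) ≤ α p) ∧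
  leftmin n α i < α i ∧ α j < rightmax n α j

/-- `center_α(i,j) = max{m : i ≤ m ≤ j and α_m ≥ rightmax_α(j)}` (as a 0-indexed position). -/
def center (n : ℕ) (α : Fin n → ℕ) (i j : Fin n) : ℕ :=
  Finset.sup (Finset.univ.filter fun p : Fin n => i ≤ p ∧ p ≤ j ∧ rightmax n α j ≤ α p)
    fun p => p.1

/-- Partial sum `β_1 + ⋯ + β_{m+1}` (0-indexed positions `≤ m`) of an integer vector. -/
def psumZ (n : ℕ) (β : Fin n → ℤ) (m : ℕ) : ℤ :=
  ∑ p ∈ Finset.univ.filter (fun p : Fin n => p.1 ≤ m), β p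

/-- Partial sum of a composition, as an integer. -/
def psumN (n : ℕ) (α : Fin n → ℕ) (m : ℕ) : ℤ :=
  ∑ p ∈ Finset.univ.filter (fun p : Fin n => p.1 ≤ m), (α p : ℤ)

/-- Composition pattern containment. -/
def ContainsPat (n : ℕ) {m : ℕ} (α : Fin n → ℕ) (pat : Fin m → ℕ) : Prop :=
  ∃ g : Fin m → Fin n, StrictMono g ∧
    (∀ s t : Fin m, pat s ≤ pat t ↔ α (g s) ≤ α (g t)) ∧
    ∀ s t : Fin m, |(pat s : ℤ) - (pat t : ℤ)| ≤ |(α (g s) : ℤ) - (α (g t) : ℤ)|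

end

end LSS

open scoped Classical

set_option linter.unusedSimpArgs false
namespace LSS
open MvPolynomial

theorem exists_dem {n : ℕ} (a b : Fin n) (f : MvPolynomial (Fin n) ℤ) :
    ∃ g, (X a - X b) * g = X a * f - X b * rename (⇑(Equiv.swap a b)) f := by
  have key : ∀ f : MvPolynomial (Fin n) ℤ, (X a - X b) ∣ f - rename (⇑(Equiv.swap a b)) f := by
    intro f
    induction f using MvPolynomial.induction_on with
    | C r => simp
    | add p q hp hq =>
      have := dvd_add hp hq
      rw [map_add]
      convert this using 1
      ring
    | mul_X p i hp =>
      rw [map_mul, rename_X]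
      have h2 : (X a - X b : MvPolynomial (Fin n) ℤ) ∣ X i - X (Equiv.swap a b i) := by
        by_cases hia : i = a
        · subst hia; simp
        · by_cases hib : i = b
          · subst hib
            rw [Equiv.swap_apply_right]
            exact ⟨-1, by ring⟩
          · rw [Equiv.swap_apply_of_ne_of_ne hia hib]; simp
      have := dvd_add (Dvd.dvd.mul_right hp (X i)) (Dvd.dvd.mul_left h2 (rename (⇑(Equiv.swap a b)) p))
      convert this using 1
      ring
  obtain ⟨g, hg⟩ := key f
  refine ⟨X a * g + rename (⇑(Equiv.swap a b)) f, ?_⟩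
  linear_combination (-X a) * hg

/-- positions -/
theorem XX_ne {n : ℕ} {a b : Fin n} (h : a ≠ b) : (X a - X b : MvPolynomial (Fin n) ℤ) ≠ 0 := by
  intro h2
  exact h (X_injective (R := ℤ) (sub_eq_zero.mp h2))

theorem dem_spec {n p : ℕ} (hp : p + 1 < n) (f : MvPolynomial (Fin n) ℤ) :
    (X (⟨p, by omega⟩ : Fin n) - X (⟨p + 1, hp⟩ : Fin n)) * dem n (p + 1) f =
      X (⟨p, by omega⟩ : Fin n) * f - X (⟨p + 1, hp⟩ : Fin n) *
        rename (⇑(Equiv.swap (⟨p, by omega⟩ : Fin n) ⟨p + 1, hp⟩)) f := by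
  unfold dem
  rw [dif_pos ⟨Nat.succ_pos p, hp⟩]
  have hg := exists_dem (⟨p, by omega⟩ : Fin n) ⟨p + 1, hp⟩ f
  have hg' : ∃ g, (X (⟨p + 1 - 1, by omega⟩ : Fin n) - X (⟨p + 1, hp⟩ : Fin n)) * g =
        X (⟨p + 1 - 1, by omega⟩ : Fin n) * f -
          X (⟨p + 1, hp⟩ : Fin n) *
            rename (⇑(Equiv.swap (⟨p + 1 - 1, by omega⟩ : Fin n) (⟨p + 1, hp⟩ : Fin n))) f := hg
  rw [dif_pos hg']
  exact hg'.choose_spec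

theorem pne {n p : ℕ} (hp : p + 1 < n) : (⟨p, by omega⟩ : Fin n) ≠ ⟨p + 1, hp⟩ := by
  intro h; simp at h

theorem dem_unique {n p : ℕ} (hp : p + 1 < n) (f g : MvPolynomial (Fin n) ℤ)
    (h : (X (⟨p, by omega⟩ : Fin n) - X (⟨p + 1, hp⟩ : Fin n)) * g =
      X (⟨p, by omega⟩ : Fin n) * f - X (⟨p + 1, hp⟩ : Fin n) *
        rename (⇑(Equiv.swap (⟨p, by omega⟩ : Fin n) ⟨p + 1, hp⟩)) f) :
    dem n (p + 1) f = g :=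
  mul_left_cancel₀ (XX_ne (pne hp)) ((dem_spec hp f).trans h.symm)

theorem dem_add {n p : ℕ} (hp : p + 1 < n) (f g : MvPolynomial (Fin n) ℤ) :
    dem n (p + 1) (f + g) = dem n (p + 1) f + dem n (p + 1) g := by
  apply dem_unique hp
  rw [map_add]
  linear_combination dem_spec hp f + dem_spec hp g

theorem dem_zero {n p : ℕ} (hp : p + 1 < n) : dem n (p + 1) 0 = 0 := by
  apply dem_unique hp
  simp

theorem dem_smul {n p : ℕ} (hp : p + 1 < n) (c : ℤ) (f : MvPolynomial (Fin n) ℤ) :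
    dem n (p + 1) (c • f) = c • dem n (p + 1) f := by
  apply dem_unique hp
  rw [smul_eq_C_mul, smul_eq_C_mul, map_mul, rename_C]
  linear_combination C c * dem_spec hp f

theorem dem_sum {n p : ℕ} (hp : p + 1 < n) {ι : Type*} (s : Finset ι)
    (F : ι → MvPolynomial (Fin n) ℤ) :
    dem n (p + 1) (∑ i ∈ s, F i) = ∑ i ∈ s, dem n (p + 1) (F i) := by
  induction s using Finset.induction_on with
  | empty => simp [dem_zero hp]
  | insert a s ha ih => rw [Finset.sum_insert ha, Finset.sum_insert ha, dem_add hp, ih]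

theorem rename_rename_swap {n : ℕ} (a b : Fin n) (f : MvPolynomial (Fin n) ℤ) :
    rename (⇑(Equiv.swap a b)) (rename (⇑(Equiv.swap a b)) f) = f := by
  rw [rename_rename]
  have : (⇑(Equiv.swap a b) ∘ ⇑(Equiv.swap a b)) = id := by
    funext x; simp
  rw [this, rename_id]; rfl

theorem dem_symm {n p : ℕ} (hp : p + 1 < n) (f : MvPolynomial (Fin n) ℤ) :
    rename (⇑(Equiv.swap (⟨p, by omega⟩ : Fin n) ⟨p + 1, hp⟩)) (dem n (p + 1) f) =
      dem n (p + 1) f := by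
  symm
  apply dem_unique hp
  have h := congrArg (rename (⇑(Equiv.swap (⟨p, by omega⟩ : Fin n) ⟨p + 1, hp⟩))) (dem_spec hp f)
  simp only [map_mul, map_sub, rename_X, rename_rename_swap, Equiv.swap_apply_left,
    Equiv.swap_apply_right] at h
  linear_combination -h

theorem dem_of_symm {n p : ℕ} (hp : p + 1 < n) (f : MvPolynomial (Fin n) ℤ)
    (h : rename (⇑(Equiv.swap (⟨p, by omega⟩ : Fin n) ⟨p + 1, hp⟩)) f = f) :
    dem n (p + 1) f = f := by
  apply dem_unique hp
  rw [h]; ring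

theorem dem_idem {n p : ℕ} (hp : p + 1 < n) (f : MvPolynomial (Fin n) ℤ) :
    dem n (p + 1) (dem n (p + 1) f) = dem n (p + 1) f :=
  dem_of_symm hp _ (dem_symm hp f)

theorem rename_comm {n : ℕ} (σ τ : Equiv.Perm (Fin n)) (f : MvPolynomial (Fin n) ℤ) :
    rename (⇑σ) (rename (⇑τ) f) = rename (⇑(σ * τ)) f := by
  rw [rename_rename]; rfl

theorem dem_comm {n p q : ℕ} (hp : p + 1 < n) (hq : q + 1 < n) (hpq : p + 1 < q)
    (f : MvPolynomial (Fin n) ℤ) :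
    dem n (p + 1) (dem n (q + 1) f) = dem n (q + 1) (dem n (p + 1) f) := by
  set a : Fin n := ⟨p, by omega⟩ with ha
  set b : Fin n := ⟨p + 1, hp⟩ with hb
  set c : Fin n := ⟨q, by omega⟩ with hc
  set e : Fin n := ⟨q + 1, hq⟩ with he
  have hac : a ≠ c := by simp [ha, hc]; omega
  have hae : a ≠ e := by simp [ha, he]; omega
  have hbc : b ≠ c := by simp [hb, hc]; omega
  have hbe : b ≠ e := by simp [hb, he]; omega
  have hab : a ≠ b := pne hp
  have hce : c ≠ e := pne hq
  -- naming
  set s := Equiv.swap a b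
  set t := Equiv.swap c e
  have hst : s * t = t * s := by
    apply Equiv.Perm.Disjoint.commute
    exact Equiv.Perm.disjoint_swap_swap (by simp [hac, hae, hbc, hbe, hab, hce])
  have e1 := dem_spec hp f
  have e2 := dem_spec hq f
  have e3 := dem_spec hp (dem n (q + 1) f)
  have e4 := dem_spec hq (dem n (p + 1) f)
  have e5 := congrArg (rename (⇑s)) e2
  have e6 := congrArg (rename (⇑t)) e1
  simp only [← ha, ← hb, ← hc, ← he] at e1 e2 e3 e4 e5 e6
  have sc : s c = c := Equiv.swap_apply_of_ne_of_ne hac.symm hbc.symm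
  have se : s e = e := Equiv.swap_apply_of_ne_of_ne hae.symm hbe.symm
  have ta : t a = a := Equiv.swap_apply_of_ne_of_ne hac hae
  have tb : t b = b := Equiv.swap_apply_of_ne_of_ne hbc hbe
  simp only [map_mul, map_sub, rename_X] at e5 e6
  change (X (s c) - X (s e)) * _ = X (s c) * _ - X (s e) * rename (⇑s) (rename (⇑t) f) at e5
  change (X (t a) - X (t b)) * _ = X (t a) * _ - X (t b) * rename (⇑t) (rename (⇑s) f) at e6
  rw [rename_comm, sc, se] at e5
  rw [rename_comm, ← hst, ta, tb] at e6
  apply mul_left_cancel₀ (mul_ne_zero (XX_ne hab) (XX_ne hce))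
  change _ = X a * _ - X b * rename (⇑s) _ at e1
  change _ = X c * _ - X e * rename (⇑t) _ at e2
  change _ = X a * _ - X b * rename (⇑s) _ at e3
  change _ = X c * _ - X e * rename (⇑t) _ at e4
  linear_combination (X c - X e) * e3 + X a * e2 - X b * e5 - ((X a - X b) * e4 + X c * e1 - X e * e6)

theorem dem_braid {n p : ℕ} (hp : p + 2 < n) (f : MvPolynomial (Fin n) ℤ) :
    dem n (p + 1) (dem n (p + 2) (dem n (p + 1) f)) =
      dem n (p + 2) (dem n (p + 1) (dem n (p + 2) f)) := by
  have hp1 : p + 1 < n := by omega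
  have hp2 : (p + 1) + 1 < n := hp
  set a : Fin n := ⟨p, by omega⟩ with ha
  set b : Fin n := ⟨p + 1, hp1⟩ with hb
  set c : Fin n := ⟨p + 1 + 1, hp⟩ with hc
  have hab : a ≠ b := by simp [ha, hb]
  have hac : a ≠ c := by simp [ha, hc]; omega
  have hbc : b ≠ c := by simp [hb, hc]
  set s := Equiv.swap a b with hs
  set t := Equiv.swap b c with ht
  have sa : s a = b := Equiv.swap_apply_left _ _
  have sb : s b = a := Equiv.swap_apply_right _ _
  have sc : s c = c := Equiv.swap_apply_of_ne_of_ne hac.symm hbc.symm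
  have ta : t a = a := Equiv.swap_apply_of_ne_of_ne hab hac
  have tb : t b = c := Equiv.swap_apply_left _ _
  have tc : t c = b := Equiv.swap_apply_right _ _
  have S : ∀ g, (X a - X b) * dem n (p + 1) g = X a * g - X b * rename (⇑s) g :=
    fun g => dem_spec hp1 g
  have T : ∀ g, (X b - X c) * dem n (p + 2) g = X b * g - X c * rename (⇑t) g :=
    fun g => dem_spec hp2 g
  have tS : ∀ g, (X a - X c) * rename (⇑t) (dem n (p + 1) g) =
      X a * rename (⇑t) g - X c * rename (⇑t) (rename (⇑s) g) := by
    intro g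
    have := congrArg (rename (⇑t)) (S g)
    simpa only [map_mul, map_sub, rename_X, ta, tb] using this
  have sT : ∀ g, (X a - X c) * rename (⇑s) (dem n (p + 2) g) =
      X a * rename (⇑s) g - X c * rename (⇑s) (rename (⇑t) g) := by
    intro g
    have := congrArg (rename (⇑s)) (T g)
    simpa only [map_mul, map_sub, rename_X, sb, sc] using this
  have stS : ∀ g, (X b - X c) * rename (⇑s) (rename (⇑t) (dem n (p + 1) g)) =
      X b * rename (⇑s) (rename (⇑t) g) - X c * rename (⇑s) (rename (⇑t) (rename (⇑s) g)) := by
    intro g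
    have := congrArg (rename (⇑s)) (tS g)
    simpa only [map_mul, map_sub, rename_X, sa, sc] using this
  have tsT : ∀ g, (X a - X b) * rename (⇑t) (rename (⇑s) (dem n (p + 2) g)) =
      X a * rename (⇑t) (rename (⇑s) g) - X b * rename (⇑t) (rename (⇑s) (rename (⇑t) g)) := by
    intro g
    have := congrArg (rename (⇑t)) (sT g)
    simpa only [map_mul, map_sub, rename_X, ta, tc] using this
  have hbr : rename (⇑s) (rename (⇑t) (rename (⇑s) f)) = rename (⇑t) (rename (⇑s) (rename (⇑t) f)) := by
    rw [rename_comm, rename_comm, rename_comm, rename_comm]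
    congr 2
    ext x
    simp only [Equiv.Perm.coe_mul, Function.comp_apply]
    by_cases h1 : x = a
    · subst h1; simp only [sa, ta, tb, sb, sc, tc]
    · by_cases h2 : x = b
      · rw [h2]; simp only [sa, ta, tb, sb, sc, tc]
      · by_cases h3 : x = c
        · rw [h3]; simp only [sa, ta, tb, sb, sc, tc]
        · have hsx : s x = x := Equiv.swap_apply_of_ne_of_ne h1 h2
          have htx : t x = x := Equiv.swap_apply_of_ne_of_ne h2 h3
          simp only [hsx, htx]
  have ss : rename (⇑s) (dem n (p + 1) f) = dem n (p + 1) f := dem_symm hp1 f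
  have tt : rename (⇑t) (dem n (p + 2) f) = dem n (p + 2) f := dem_symm hp2 f
  apply mul_left_cancel₀ (mul_ne_zero (mul_ne_zero (XX_ne hab) (XX_ne hac)) (XX_ne hbc))
  have l1 := S (dem n (p + 2) (dem n (p + 1) f))
  have l2 := T (dem n (p + 1) f)
  have l3 := sT (dem n (p + 1) f)
  rw [ss] at l3
  have l4 := S f
  have l5 := tS f
  have l6 := stS f
  have r1 := T (dem n (p + 1) (dem n (p + 2) f))
  have r2 := S (dem n (p + 2) f)
  have r3 := tS (dem n (p + 2) f)
  rw [tt] at r3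
  have r4 := T f
  have r5 := sT f
  have r6 := tsT f
  rw [hbr] at l6
  linear_combination (X a - X c) * (X b - X c) * l1 + (X a - X c) * X a * l2 - (X b - X c) * X b * l3
    + X a * X b * l4 - X a * X c * l5 + X b * X c * l6 - X a ^ 2 * r4 + X b ^ 2 * r5 - X c ^ 2 * r6
    - ((X a - X c) * (X a - X b) * r1 + (X a - X c) * X b * r2 - (X a - X b) * X c * r3)

end LSS

open scoped Classical
set_option linter.unusedSimpArgs false

namespace LSS
open MvPolynomial

/-- adjacent transposition of positions p, p+1 -/
noncomputable def asw {n p : ℕ} (hp : p + 1 < n) : Equiv.Perm (Fin n) :=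
  Equiv.swap ⟨p, by omega⟩ ⟨p + 1, hp⟩

theorem st_eq {n p : ℕ} (hp : p + 1 < n) : st n (p + 1) = asw hp := by
  unfold st
  rw [dif_pos ⟨Nat.succ_pos p, hp⟩]
  rfl

theorem asw_val {n p : ℕ} (hp : p + 1 < n) (i : Fin n) :
    (asw hp i).1 = if i.1 = p then p + 1 else if i.1 = p + 1 then p else i.1 := by
  unfold asw
  rw [Equiv.swap_apply_def]
  split_ifs <;> simp_all [Fin.ext_iff]

theorem asw_left {n p : ℕ} (hp : p + 1 < n) : asw hp ⟨p, by omega⟩ = ⟨p + 1, hp⟩ :=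
  Equiv.swap_apply_left _ _

theorem asw_right {n p : ℕ} (hp : p + 1 < n) : asw hp ⟨p + 1, hp⟩ = ⟨p, by omega⟩ :=
  Equiv.swap_apply_right _ _

theorem asw_inv {n p : ℕ} (hp : p + 1 < n) : (asw hp)⁻¹ = asw hp := Equiv.swap_inv _ _

theorem asw_asw {n p : ℕ} (hp : p + 1 < n) (i : Fin n) : asw hp (asw hp i) = i :=
  Equiv.swap_apply_self _ _ _

theorem asw_mul_self {n p : ℕ} (hp : p + 1 < n) : asw hp * asw hp = 1 := Equiv.swap_mul_self _ _

theorem asw_lt {n p : ℕ} (hp : p + 1 < n) {i j : Fin n} (h : i < j)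
    (hne : ¬ (i.1 = p ∧ j.1 = p + 1)) : asw hp i < asw hp j := by
  rw [Fin.lt_def, asw_val, asw_val]
  rw [Fin.lt_def] at h
  split_ifs <;> omega

/-- number of ascending pairs -/
noncomputable def ascN {n : ℕ} (α : Fin n → ℕ) : ℕ :=
  (Finset.univ.filter fun q : Fin n × Fin n => q.1 < q.2 ∧ α q.1 < α q.2).card

theorem ascN_swap {n p : ℕ} (hp : p + 1 < n) (α : Fin n → ℕ)
    (h : α ⟨p, by omega⟩ < α ⟨p + 1, hp⟩) : ascN (α ∘ asw hp) < ascN α := by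
  unfold ascN
  rw [← Finset.card_image_of_injective (f := fun q : Fin n × Fin n => (asw hp q.1, asw hp q.2))]
  · apply Finset.card_lt_card
    rw [Finset.ssubset_iff_of_subset]
    · refine ⟨(⟨p, by omega⟩, ⟨p + 1, hp⟩), by simpa using h, ?_⟩
      intro hm
      rw [Finset.mem_image] at hm
      obtain ⟨q, hq, he⟩ := hm
      rw [Prod.mk.injEq] at he
      have h1 : q.1 = ⟨p + 1, hp⟩ := by rw [← asw_asw hp q.1, he.1, asw_left]
      have h2 : q.2 = ⟨p, by omega⟩ := by rw [← asw_asw hp q.2, he.2, asw_right]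
      simp only [Finset.mem_filter, h1, h2, Fin.lt_def] at hq
      omega
    · intro r hr
      rw [Finset.mem_image] at hr
      obtain ⟨q, hq, rfl⟩ := hr
      simp only [Finset.mem_filter, Finset.mem_univ, true_and, Function.comp_apply] at hq ⊢
      refine ⟨asw_lt hp hq.1 ?_, hq.2⟩
      rintro ⟨h1, h2⟩
      have h1' : q.1 = ⟨p, by omega⟩ := Fin.ext h1
      have h2' : q.2 = ⟨p + 1, hp⟩ := Fin.ext h2
      rw [h1', h2', asw_left, asw_right] at hq
      omega
  · intro x y hxy
    simp only [Prod.mk.injEq, EmbeddingLike.apply_eq_iff_eq] at hxy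
    exact Prod.ext hxy.1 hxy.2

theorem ascN_le {n : ℕ} (α : Fin n → ℕ) : ascN α ≤ n * n := by
  unfold ascN
  refine (Finset.card_le_univ _).trans ?_
  simp

theorem ent_asc {n : ℕ} (α : Fin n → ℕ) (p : ℕ) (h : ent n α p < ent n α (p + 1)) :
    ∃ hp : p + 1 < n, α ⟨p, by omega⟩ < α ⟨p + 1, hp⟩ := by
  unfold ent at h
  split_ifs at h with h1 h2
  · exact ⟨h2, h⟩
  · omega
  · omega
  · omega

theorem asc_ent {n p : ℕ} (α : Fin n → ℕ) (hp : p + 1 < n)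
    (h : α ⟨p, by omega⟩ < α ⟨p + 1, hp⟩) : ent n α p < ent n α (p + 1) := by
  unfold ent
  rw [dif_pos hp, dif_pos (by omega)]
  exact h

theorem swapAt_eq {n p : ℕ} (hp : p + 1 < n) (α : Fin n → ℕ) :
    swapAt n p α = α ∘ asw hp := by
  funext m
  unfold swapAt ent
  rw [dif_pos hp, dif_pos (by omega : p < n), Function.comp_apply]
  split_ifs with h1 h2
  · have : m = ⟨p, by omega⟩ := Fin.ext h1
    rw [this, asw_left]
  · have : m = ⟨p + 1, hp⟩ := Fin.ext h2
    rw [this, asw_right]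
  · congr 1
    apply Fin.ext
    rw [asw_val, if_neg h1, if_neg h2]

theorem keyAux_fuel {n : ℕ} : ∀ (k k' : ℕ) (α : Fin n → ℕ), ascN α ≤ k → ascN α ≤ k' →
    keyAux n k α = keyAux n k' α := by
  have base : ∀ (k' : ℕ) (α : Fin n → ℕ), ascN α = 0 → keyAux n k' α = mono n α := by
    intro k' α h0
    cases k' with
    | zero => rfl
    | succ k' =>
      unfold keyAux
      rw [dif_neg]
      rintro ⟨p, hp⟩
      obtain ⟨hp, h⟩ := ent_asc α _ hp
      have := ascN_swap hp α h
      omega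
  intro k
  induction k with
  | zero =>
    intro k' α h h'
    rw [base 0 α (by omega), base k' α (by omega)]
  | succ k ih =>
    intro k' α h h'
    cases k' with
    | zero => rw [base (k + 1) α (by omega), base 0 α (by omega)]
    | succ k' =>
      unfold keyAux
      split_ifs with hex
      · obtain ⟨hp, hlt⟩ := ent_asc α _ hex.choose_spec
        have hs := ascN_swap hp α hlt
        rw [swapAt_eq hp, ih k' _ (by omega) (by omega)]
      · rfl

theorem keyPoly_cases {n : ℕ} (α : Fin n → ℕ) :
    ((∀ p, ∀ hp : p + 1 < n, α ⟨p + 1, hp⟩ ≤ α ⟨p, by omega⟩) ∧ keyPoly n α = mono n α) ∨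
    ∃ p, ∃ hp : p + 1 < n, α ⟨p, by omega⟩ < α ⟨p + 1, hp⟩ ∧
      keyPoly n α = dem n (p + 1) (keyPoly n (α ∘ asw hp)) := by
  have hk : keyPoly n α = keyAux n (n * n + 1) α :=
    keyAux_fuel _ _ _ (ascN_le α) ((ascN_le α).trans (Nat.le_succ _))
  rw [hk]
  unfold keyAux
  split_ifs with hex
  · right
    obtain ⟨hp, hlt⟩ := ent_asc α _ hex.choose_spec
    refine ⟨_, hp, hlt, ?_⟩
    rw [swapAt_eq hp]
    rfl
  · left
    refine ⟨?_, rfl⟩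
    intro p hp
    by_contra hc
    exact hex ⟨⟨p, by omega⟩, asc_ent α hp (not_le.mp hc)⟩

theorem keyPoly_dec {n : ℕ} (α : Fin n → ℕ)
    (h : ∀ p, ∀ hp : p + 1 < n, α ⟨p + 1, hp⟩ ≤ α ⟨p, by omega⟩) : keyPoly n α = mono n α := by
  rcases keyPoly_cases α with h1 | ⟨p, hp, h1, -⟩
  · exact h1.2
  · have := h p hp; omega

theorem asw_comm {n p q : ℕ} (hp : p + 1 < n) (hq : q + 1 < n) (hpq : p + 1 < q)
    (α : Fin n → ℕ) : (α ∘ asw hp) ∘ asw hq = (α ∘ asw hq) ∘ asw hp := by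
  funext m
  simp only [Function.comp_apply]
  congr 1
  apply Fin.ext
  simp only [asw_val]
  split_ifs <;> omega

theorem asw_braid {n p : ℕ} (hp : p + 1 < n) (hq : p + 1 + 1 < n)
    (α : Fin n → ℕ) : ((α ∘ asw hp) ∘ asw hq) ∘ asw hp = ((α ∘ asw hq) ∘ asw hp) ∘ asw hq := by
  funext m
  simp only [Function.comp_apply]
  congr 1
  apply Fin.ext
  simp only [asw_val]
  split_ifs <;> omega

theorem asw_of_ne {n p : ℕ} (hp : p + 1 < n) (i : Fin n) (h1 : i.1 ≠ p) (h2 : i.1 ≠ p + 1) :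
    asw hp i = i := by
  apply Fin.ext
  rw [asw_val, if_neg h1, if_neg h2]

theorem keyPoly_step {n : ℕ} : ∀ (N : ℕ) (α : Fin n → ℕ), ascN α ≤ N → ∀ p (hp : p + 1 < n),
    α ⟨p, by omega⟩ < α ⟨p + 1, hp⟩ →
    keyPoly n α = dem n (p + 1) (keyPoly n (α ∘ asw hp)) := by
  intro N
  induction N with
  | zero =>
    intro α h p hp hlt
    have := ascN_swap hp α hlt
    omega
  | succ N ih =>
    intro α hN p hp hlt
    rcases keyPoly_cases α with h1 | ⟨q, hq, hltq, hK⟩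
    · have := h1.1 p hp; omega
    · have hsp := ascN_swap hp α hlt
      have hsq := ascN_swap hq α hltq
      -- generic commuting case
      have far : ∀ (p q : ℕ) (hp : p + 1 < n) (hq : q + 1 < n),
          α ⟨p, by omega⟩ < α ⟨p + 1, hp⟩ → α ⟨q, by omega⟩ < α ⟨q + 1, hq⟩ → p + 1 < q →
          dem n (p + 1) (keyPoly n (α ∘ asw hp)) = dem n (q + 1) (keyPoly n (α ∘ asw hq)) := by
        intro p q hp hq hlt hltq hpq
        have hsp := ascN_swap hp α hlt
        have hsq := ascN_swap hq α hltq
        rw [ih (α ∘ asw hp) (by omega) q hq, ih (α ∘ asw hq) (by omega) p hp, asw_comm hp hq hpq,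
          dem_comm hp hq hpq]
        · simp only [Function.comp_apply]
          rw [asw_of_ne hq ⟨p, by omega⟩ (by simp only; omega) (by simp only; omega),
            asw_of_ne hq ⟨p + 1, by omega⟩ (by simp only; omega) (by simp only; omega)]
          exact hlt
        · simp only [Function.comp_apply]
          rw [asw_of_ne hp ⟨q, by omega⟩ (by simp only; omega) (by simp only; omega),
            asw_of_ne hp ⟨q + 1, by omega⟩ (by simp only; omega) (by simp only; omega)]
          exact hltq
      have near : ∀ (p : ℕ) (hp : p + 1 < n) (hq : p + 1 + 1 < n),
          α ⟨p, by omega⟩ < α ⟨p + 1, hp⟩ → α ⟨p + 1, by omega⟩ < α ⟨p + 1 + 1, hq⟩ →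
          dem n (p + 1) (keyPoly n (α ∘ asw hp)) =
            dem n (p + 1 + 1) (keyPoly n (α ∘ asw hq)) := by
        intro p hp hq hlt hltq
        have hsp := ascN_swap hp α hlt
        have hsq := ascN_swap hq α hltq
        have c1 : asw hq ⟨p, by omega⟩ = ⟨p, by omega⟩ := asw_of_ne hq _ (by simp) (by simp; omega)
        have c2 : asw hp ⟨p + 1 + 1, hq⟩ = ⟨p + 1 + 1, hq⟩ :=
          asw_of_ne hp _ (by simp; omega) (by simp)
        have a1 : (α ∘ asw hp) ⟨p + 1, hp⟩ < (α ∘ asw hp) ⟨p + 1 + 1, hq⟩ := by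
          simp only [Function.comp_apply, asw_right, c2]; omega
        have a2 : (α ∘ asw hq) ⟨p, by omega⟩ < (α ∘ asw hq) ⟨p + 1, hp⟩ := by
          simp only [Function.comp_apply, asw_left, c1]; omega
        have hs1 := ascN_swap hq (α ∘ asw hp) a1
        have hs2 := ascN_swap hp (α ∘ asw hq) a2
        rw [ih (α ∘ asw hp) (by omega) (p + 1) hq a1, ih (α ∘ asw hq) (by omega) p hp a2,
          ih ((α ∘ asw hp) ∘ asw hq) (by omega) p hp, ih ((α ∘ asw hq) ∘ asw hp) (by omega) (p + 1) hq,
          asw_braid hp hq, dem_braid hq]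
        · simp only [Function.comp_apply, asw_left, asw_right, c1, c2]; omega
        · simp only [Function.comp_apply, asw_left, asw_right, c1, c2]; omega
      rw [hK]
      rcases Nat.lt_trichotomy p q with h | h | h
      · rcases Nat.lt_or_ge (p + 1) q with h' | h'
        · exact (far p q hp hq hlt hltq h').symm
        · obtain rfl : q = p + 1 := by omega
          exact (near p hp hq hlt hltq).symm
      · subst h; rfl
      · rcases Nat.lt_or_ge (q + 1) p with h' | h'
        · exact far q p hq hp hltq hlt h'
        · obtain rfl : p = q + 1 := by omega
          exact near q hq hp hltq hlt

theorem key_up {n p : ℕ} (hp : p + 1 < n) (α : Fin n → ℕ)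
    (h : α ⟨p + 1, hp⟩ < α ⟨p, by omega⟩) :
    dem n (p + 1) (keyPoly n α) = keyPoly n (α ∘ asw hp) := by
  have := keyPoly_step _ (α ∘ asw hp) le_rfl p hp
    (by simpa only [Function.comp_apply, asw_left, asw_right] using h)
  rw [this]
  congr 2
  funext m
  simp only [Function.comp_apply, asw_asw]

theorem rename_mono {n : ℕ} (σ : Equiv.Perm (Fin n)) (β : Fin n → ℕ) :
    rename (⇑σ) (mono n β) = mono n (β ∘ ⇑σ⁻¹) := by
  unfold mono
  rw [rename_monomial]
  have : Finsupp.mapDomain (⇑σ) (expOf n β) = expOf n (β ∘ ⇑σ⁻¹) := by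
    ext i
    obtain ⟨j, rfl⟩ := σ.surjective i
    rw [Finsupp.mapDomain_apply σ.injective]
    simp [expOf, Finsupp.equivFunOnFinite]
  rw [this]

theorem comp_asw_eq {n p : ℕ} (hp : p + 1 < n) (α : Fin n → ℕ)
    (h : α ⟨p, by omega⟩ = α ⟨p + 1, hp⟩) : α ∘ asw hp = α := by
  funext m
  rw [Function.comp_apply]
  by_cases h1 : m.1 = p
  · have : m = ⟨p, by omega⟩ := Fin.ext h1
    rw [this, asw_left, h]
  · by_cases h2 : m.1 = p + 1
    · have : m = ⟨p + 1, hp⟩ := Fin.ext h2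
      rw [this, asw_right, h]
    · rw [asw_of_ne hp m h1 h2]

theorem key_eq {n : ℕ} : ∀ (N : ℕ) (α : Fin n → ℕ), ascN α ≤ N → ∀ p (hp : p + 1 < n),
    α ⟨p, by omega⟩ = α ⟨p + 1, hp⟩ → dem n (p + 1) (keyPoly n α) = keyPoly n α := by
  intro N
  induction N using Nat.strong_induction_on with
  | _ N ih =>
    intro α hN p hp he
    rcases keyPoly_cases α with ⟨-, h1⟩ | ⟨q, hq, hltq, hK⟩
    · rw [h1]
      apply dem_of_symm hp
      change rename (⇑(asw hp)) _ = _
      rw [rename_mono, asw_inv, comp_asw_eq hp α he]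
    · have hsq := ascN_swap hq α hltq
      rcases Nat.lt_trichotomy p q with h | h | h
      · rcases Nat.lt_or_ge (p + 1) q with h' | h'
        · rw [hK, dem_comm hp hq h', ih _ (by omega) (α ∘ asw hq) le_rfl p hp]
          simp only [Function.comp_apply]
          rw [asw_of_ne hq, asw_of_ne hq, he] <;> simp <;> omega
        · obtain rfl : q = p + 1 := by omega
          have c1 : asw hq ⟨p, by omega⟩ = ⟨p, by omega⟩ := asw_of_ne hq _ (by simp) (by simp; omega)
          have c2 : asw hp ⟨p + 1 + 1, hq⟩ = ⟨p + 1 + 1, hq⟩ :=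
            asw_of_ne hp _ (by simp; omega) (by simp)
          have a2 : (α ∘ asw hq) ⟨p, by omega⟩ < (α ∘ asw hq) ⟨p + 1, hp⟩ := by
            simp only [Function.comp_apply, asw_left, c1]; omega
          have hs2 := ascN_swap hp (α ∘ asw hq) a2
          have hK2 := keyPoly_step _ (α ∘ asw hq) le_rfl p hp a2
          rw [hK, hK2, dem_braid hq, ih _ (by omega) ((α ∘ asw hq) ∘ asw hp) le_rfl (p + 1) hq]
          simp only [Function.comp_apply, asw_left, asw_right, c1, c2]; omega
      · subst h; omega
      · rcases Nat.lt_or_ge (q + 1) p with h' | h'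
        · rw [hK, ← dem_comm hq hp h', ih _ (by omega) (α ∘ asw hq) le_rfl p hp]
          simp only [Function.comp_apply]
          rw [asw_of_ne hq, asw_of_ne hq, he] <;> simp <;> omega
        · obtain rfl : p = q + 1 := by omega
          have c1 : asw hp ⟨q, by omega⟩ = ⟨q, by omega⟩ := asw_of_ne hp _ (by simp) (by simp; omega)
          have c2 : asw hq ⟨q + 1 + 1, hp⟩ = ⟨q + 1 + 1, hp⟩ :=
            asw_of_ne hq _ (by simp; omega) (by simp)
          have a2 : (α ∘ asw hq) ⟨q + 1, by omega⟩ < (α ∘ asw hq) ⟨q + 1 + 1, hp⟩ := by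
            simp only [Function.comp_apply, asw_right, c2]; omega
          have hs2 := ascN_swap hp (α ∘ asw hq) a2
          have hK2 := keyPoly_step _ (α ∘ asw hq) le_rfl (q + 1) hp a2
          rw [hK, hK2, ← dem_braid hp, ih _ (by omega) ((α ∘ asw hq) ∘ asw hp) le_rfl q hq]
          simp only [Function.comp_apply, asw_left, asw_right, c1, c2]; omega

/-- `π_p κ_α = κ_{s_p α}` if `α_p ≥ α_{p+1}`. -/
theorem key_up' {n p : ℕ} (hp : p + 1 < n) (α : Fin n → ℕ)
    (h : α ⟨p + 1, hp⟩ ≤ α ⟨p, by omega⟩) :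
    dem n (p + 1) (keyPoly n α) = keyPoly n (α ∘ asw hp) := by
  rcases h.lt_or_eq with h | h
  · exact key_up hp α h
  · rw [comp_asw_eq hp α h.symm]
    exact key_eq _ α le_rfl p hp h.symm

/-- `π_p κ_α = κ_α` if `α_p ≤ α_{p+1}`. -/
theorem key_fix {n p : ℕ} (hp : p + 1 < n) (α : Fin n → ℕ)
    (h : α ⟨p, by omega⟩ ≤ α ⟨p + 1, hp⟩) :
    dem n (p + 1) (keyPoly n α) = keyPoly n α := by
  rcases h.lt_or_eq with h | h
  · rw [keyPoly_step _ α le_rfl p hp h, dem_idem]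
    exact hp
  · exact key_eq _ α le_rfl p hp h

end LSS

open scoped Classical
set_option linter.unusedSimpArgs false
set_option linter.unusedSectionVars false

namespace LSS
open MvPolynomial

theorem adj_chain {n : ℕ} (R : Fin n → Fin n → Prop) (tr : ∀ x y z, R x y → R y z → R x z)
    (i : Fin n) : ∀ (j : ℕ) (hj : j < n), i.1 < j →
    (∀ p (hp : p + 1 < n), i.1 ≤ p → p + 1 ≤ j → R ⟨p, by omega⟩ ⟨p + 1, hp⟩) → R i ⟨j, hj⟩ := by
  intro j
  induction j with
  | zero => intro hj h; omega
  | succ j ih =>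
    intro hj h hR
    rcases Nat.lt_or_ge i.1 j with h' | h'
    · exact tr _ _ _ (ih (by omega) h' (fun p hp h1 h2 => hR p hp h1 (by omega)))
        (hR j hj (by omega) le_rfl)
    · have : i = ⟨j, by omega⟩ := Fin.ext (by simp only; omega)
      rw [this]
      exact hR j hj (by omega) le_rfl

theorem pai {n : ℕ} (σ : Equiv.Perm (Fin n)) (i : Fin n) : σ (σ⁻¹ i) = i := by simp

theorem perm_eq_one {n : ℕ} (σ : Equiv.Perm (Fin n)) (h : StrictMono σ) : σ = 1 := by
  have h2 : (⟨σ, fun {a b} => h.le_iff_le⟩ : Fin n ≃o Fin n) = OrderIso.refl _ := Subsingleton.elim _ _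
  ext i
  have h3 := congrArg (fun e : Fin n ≃o Fin n => (e i).1) h2
  exact h3

theorem exists_descent {n : ℕ} (σ : Equiv.Perm (Fin n)) (h : σ ≠ 1) :
    ∃ p, ∃ hp : p + 1 < n, σ⁻¹ ⟨p + 1, hp⟩ < σ⁻¹ ⟨p, by omega⟩ := by
  by_contra hc
  push Not at hc
  apply h
  rw [← inv_eq_one]
  apply perm_eq_one
  intro i j hij
  refine adj_chain (fun x y => σ⁻¹ x < σ⁻¹ y) (fun x y z => lt_trans) i j.1 j.2 hij ?_
  intro p hp _ _
  apply lt_of_le_of_ne (hc p hp)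
  intro h
  have := σ⁻¹.injective h
  simp at this

theorem len_inv {n : ℕ} (w : Equiv.Perm (Fin n)) : len n w⁻¹ = len n w := by
  unfold len
  apply Finset.card_bij' (fun q _ => (w⁻¹ q.2, w⁻¹ q.1)) (fun q _ => (w q.2, w q.1))
  · intro q hq; simp at hq ⊢; exact ⟨hq.2, hq.1⟩
  · intro q hq; simp at hq ⊢; exact ⟨hq.2, hq.1⟩
  · intro q hq; simp
  · intro q hq; simp

theorem len_lt {n p : ℕ} (hp : p + 1 < n) (w : Equiv.Perm (Fin n))
    (h : w⁻¹ ⟨p, by omega⟩ < w⁻¹ ⟨p + 1, hp⟩) : len n w < len n (asw hp * w) := by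
  unfold len
  apply Finset.card_lt_card
  rw [Finset.ssubset_iff_of_subset]
  · refine ⟨(w⁻¹ ⟨p, by omega⟩, w⁻¹ ⟨p + 1, hp⟩), ?_, ?_⟩
    · simp only [Finset.mem_filter, Finset.mem_univ, true_and, h, Equiv.Perm.coe_mul,
        Function.comp_apply, pai, asw_left, asw_right, Fin.lt_def]
      omega
    · simp
  · intro q hq
    rw [Finset.mem_filter] at hq
    obtain ⟨-, hq⟩ := hq
    refine Finset.mem_filter.mpr ⟨Finset.mem_univ _, hq.1, asw_lt hp hq.2 ?_⟩
    rintro ⟨h1, h2⟩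
    have e1 : w q.2 = ⟨p, by omega⟩ := Fin.ext h1
    have e2 : w q.1 = ⟨p + 1, hp⟩ := Fin.ext h2
    rw [← e1, ← e2] at h
    simp at h
    exact absurd hq.1 (not_lt.mpr h.le)

theorem pact_asw {n p : ℕ} (hp : p + 1 < n) (w : Equiv.Perm (Fin n)) (lam : Fin n → ℕ) :
    pact n (asw hp * w) lam = pact n w lam ∘ asw hp := by
  funext i
  unfold pact
  rw [mul_inv_rev, asw_inv]
  rfl

theorem exists_word {n : ℕ} {τ : Type*} [LinearOrder τ] (b : Fin n → τ) (hb : Monotone b) :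
    ∀ (N : ℕ) (σ : Equiv.Perm (Fin n)), len n σ ≤ N → ∃ L : List ℕ, (∀ i ∈ L, 1 ≤ i ∧ i ≤ n - 1) ∧
      (L.map (st n)).prod = σ ∧ L.length ≤ len n σ ∧
      ((∀ i, b (σ i) = b i) → ∀ p (hp : p + 1 < n), p + 1 ∈ L → b ⟨p, by omega⟩ = b ⟨p + 1, hp⟩) ∧
      ∀ lam : Fin n → ℕ, IsPartition n lam → keyPoly n (pact n σ lam) = demWord n L (mono n lam) := by
  intro N
  induction N with
  | zero =>
    intro σ h
    have h1 : σ = 1 := by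
      by_contra hne
      obtain ⟨p, hp, hd⟩ := exists_descent σ hne
      have := len_lt hp (asw hp * σ) (by simpa [mul_inv_rev, asw_inv, asw_left, asw_right] using hd)
      rw [← mul_assoc, asw_mul_self, one_mul] at this
      omega
    subst h1
    refine ⟨[], by simp, by simp, by simp, by simp, ?_⟩
    intro lam hl
    exact keyPoly_dec _ (fun p hp => hl _ _ (by simp [Fin.le_def]))
  | succ N ih =>
    intro σ h
    by_cases hne : σ = 1
    · subst hne
      refine ⟨[], by simp, by simp, by simp, by simp, ?_⟩
      intro lam hl
      exact keyPoly_dec _ (fun p hp => hl _ _ (by simp [Fin.le_def]))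
    · obtain ⟨p, hp, hd⟩ := exists_descent σ hne
      have hlt : (asw hp * σ)⁻¹ ⟨p, by omega⟩ < (asw hp * σ)⁻¹ ⟨p + 1, hp⟩ := by
        simpa [mul_inv_rev, asw_inv, asw_left, asw_right] using hd
      have hl := len_lt hp (asw hp * σ) hlt
      rw [← mul_assoc, asw_mul_self, one_mul] at hl
      obtain ⟨L, h1, h2, h3, h4, h5⟩ := ih (asw hp * σ) (by omega)
      refine ⟨(p + 1) :: L, ?_, ?_, ?_, ?_, ?_⟩
      · intro i hi
        rw [List.mem_cons] at hi
        rcases hi with rfl | hi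
        · omega
        · exact h1 i hi
      · rw [List.map_cons, List.prod_cons, h2, st_eq hp, ← mul_assoc, asw_mul_self, one_mul]
      · rw [List.length_cons]; omega
      · intro hpres
        have hpi : ∀ i, b (σ⁻¹ i) = b i := by
          intro i
          have := hpres (σ⁻¹ i)
          rw [pai] at this
          exact this.symm
        have hbp : b ⟨p, by omega⟩ = b ⟨p + 1, hp⟩ := by
          apply le_antisymm
          · exact hb (by simp [Fin.le_def])
          · rw [← hpi ⟨p, _⟩, ← hpi ⟨p + 1, _⟩]
            exact hb hd.le
        have hs : ∀ i, b (asw hp i) = b i := by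
          intro i
          by_cases e1 : i.1 = p
          · have : i = ⟨p, by omega⟩ := Fin.ext e1
            rw [this, asw_left, hbp]
          · by_cases e2 : i.1 = p + 1
            · have : i = ⟨p + 1, hp⟩ := Fin.ext e2
              rw [this, asw_right, hbp]
            · rw [asw_of_ne hp i e1 e2]
        intro q hq hm
        rw [List.mem_cons] at hm
        rcases hm with hm | hm
        · obtain rfl : q = p := by omega
          exact hbp
        · refine h4 ?_ q hq hm
          intro i
          rw [Equiv.Perm.mul_apply, hs, hpres]
      · intro lam hlam
        have : demWord n ((p + 1) :: L) (mono n lam) = dem n (p + 1) (demWord n L (mono n lam)) := rfl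
        rw [this, ← h5 lam hlam, key_up' hp, ← pact_asw, ← mul_assoc, asw_mul_self, one_mul]
        exact hlam _ _ hlt.le

section blocks
variable {n : ℕ} {τ : Type*} [LinearOrder τ] (b : Fin n → τ)

theorem asw_block {p : ℕ} (hp : p + 1 < n) (hbp : b ⟨p, by omega⟩ = b ⟨p + 1, hp⟩) :
    ∀ i, b (asw hp i) = b i := by
  intro i
  by_cases e1 : i.1 = p
  · have : i = ⟨p, by omega⟩ := Fin.ext e1
    rw [this, asw_left, hbp]
  · by_cases e2 : i.1 = p + 1
    · have : i = ⟨p + 1, hp⟩ := Fin.ext e2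
      rw [this, asw_right, hbp]
    · rw [asw_of_ne hp i e1 e2]

theorem block_inv {σ : Equiv.Perm (Fin n)} (h : ∀ i, b (σ i) = b i) : ∀ i, b (σ⁻¹ i) = b i := by
  intro i
  have := h (σ⁻¹ i)
  rw [pai] at this
  exact this.symm

theorem parab_block (I : Set ℕ) (hI : ∀ m ∈ I, 1 ≤ m ∧ m ≤ n - 1)
    (hIb : ∀ p (hp : p + 1 < n), p + 1 ∈ I ↔ b ⟨p, by omega⟩ = b ⟨p + 1, hp⟩)
    (σ : Equiv.Perm (Fin n)) (h : σ ∈ parab n I) : ∀ i, b (σ i) = b i := by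
  unfold parab at h
  induction h using Subgroup.closure_induction with
  | mem x hx =>
    obtain ⟨m, hm, rfl⟩ := hx
    obtain ⟨h1, h2⟩ := hI m hm
    obtain ⟨p, rfl⟩ : ∃ p, m = p + 1 := ⟨m - 1, by omega⟩
    have hp : p + 1 < n := by omega
    rw [st_eq hp]
    exact asw_block b hp ((hIb p hp).mp hm)
  | one => simp
  | mul x y _ _ hx hy => intro i; rw [Equiv.Perm.mul_apply, hx, hy]
  | inv x _ hx => exact block_inv b hx

/-- symmetric under generators implies symmetric under block permutations -/
theorem block_induct (hb : Monotone b) (P : Equiv.Perm (Fin n) → Prop) (h1 : P 1)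
    (hs : ∀ p (hp : p + 1 < n), b ⟨p, by omega⟩ = b ⟨p + 1, hp⟩ → ∀ σ, P σ → P (asw hp * σ))
    (σ : Equiv.Perm (Fin n)) (h : ∀ i, b (σ i) = b i) : P σ := by
  obtain ⟨L, h2, h3, -, h4, -⟩ := exists_word b hb _ σ le_rfl
  have h5 := h4 h
  rw [← h3]
  clear h3 h4
  induction L with
  | nil => simpa using h1
  | cons a L ih =>
    obtain ⟨ha1, ha2⟩ := h2 a (by simp)
    obtain ⟨p, rfl⟩ : ∃ p, a = p + 1 := ⟨a - 1, by omega⟩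
    have hp : p + 1 < n := by omega
    rw [List.map_cons, List.prod_cons, st_eq hp]
    apply hs p hp (h5 p hp (by simp))
    exact ih (fun i hi => h2 i (by simp [hi])) (fun q hq hm => h5 q hq (by simp [hm]))

theorem longest_anti (hb : Monotone b) (I : Set ℕ)
    (hIb : ∀ p (hp : p + 1 < n), p + 1 ∈ I ↔ b ⟨p, by omega⟩ = b ⟨p + 1, hp⟩)
    (u : Equiv.Perm (Fin n)) (hu : IsLongest n I u) (i j : Fin n) (hij : i < j) (hbij : b i = b j) :
    u j < u i := by
  refine adj_chain (fun x y => u y < u x) (fun x y z h1 h2 => lt_trans h2 h1) i j.1 j.2 hij ?_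
  intro p hp h1 h2
  have e1 : b i ≤ b ⟨p, by omega⟩ := hb (Fin.le_def.mpr h1)
  have e2 : b ⟨p + 1, hp⟩ ≤ b j := hb (Fin.le_def.mpr h2)
  have e3 : b ⟨p, by omega⟩ ≤ b ⟨p + 1, hp⟩ := hb (by simp [Fin.le_def])
  have e4 : b ⟨p, by omega⟩ = b ⟨p + 1, hp⟩ :=
    le_antisymm e3 (e2.trans (hbij ▸ e1))
  by_contra hc
  have hlt : u ⟨p, by omega⟩ < u ⟨p + 1, hp⟩ := by
    apply lt_of_le_of_ne (not_lt.mp hc)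
    intro h
    have := u.injective h
    simp at this
  have := len_lt hp u⁻¹ (by simpa using hlt)
  have h3 : len n (asw hp * u⁻¹) = len n (u * asw hp) := by
    rw [← len_inv (u * asw hp), mul_inv_rev, asw_inv]
  rw [len_inv, h3] at this
  have h4 := hu.2 (u * asw hp) (Subgroup.mul_mem _ hu.1 (Subgroup.subset_closure ⟨p + 1, (hIb p hp).mpr e4, st_eq hp⟩))
  omega

theorem desc_anti (hb : Monotone b) (I : Set ℕ)
    (hIb : ∀ p (hp : p + 1 < n), p + 1 ∈ I ↔ b ⟨p, by omega⟩ = b ⟨p + 1, hp⟩)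
    (w : Equiv.Perm (Fin n)) (hw : I ⊆ Descents n w) (i j : Fin n) (hij : i < j) (hbij : b i = b j) :
    w⁻¹ j < w⁻¹ i := by
  refine adj_chain (fun x y => w⁻¹ y < w⁻¹ x) (fun x y z h1 h2 => lt_trans h2 h1) i j.1 j.2 hij ?_
  intro p hp h1 h2
  have e1 : b i ≤ b ⟨p, by omega⟩ := hb (Fin.le_def.mpr h1)
  have e2 : b ⟨p + 1, hp⟩ ≤ b j := hb (Fin.le_def.mpr h2)
  have e3 : b ⟨p, by omega⟩ ≤ b ⟨p + 1, hp⟩ := hb (by simp [Fin.le_def])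
  have e4 : b ⟨p, by omega⟩ = b ⟨p + 1, hp⟩ :=
    le_antisymm e3 (e2.trans (hbij ▸ e1))
  by_contra hc
  have hlt : w⁻¹ ⟨p, by omega⟩ < w⁻¹ ⟨p + 1, hp⟩ := by
    apply lt_of_le_of_ne (not_lt.mp hc)
    intro h
    have := w⁻¹.injective h
    simp at this
  have := len_lt hp w hlt
  have h3 := (hw ((hIb p hp).mpr e4)).2.2
  rw [st_eq hp] at h3
  omega

/-- number of pairs `i<j` with `w⁻¹ i < w⁻¹ j`. -/
noncomputable def ninv (w : Equiv.Perm (Fin n)) : ℕ :=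
  (Finset.univ.filter fun q : Fin n × Fin n => q.1 < q.2 ∧ w⁻¹ q.1 < w⁻¹ q.2).card

noncomputable def prs : Finset (Fin n × Fin n) :=
  Finset.univ.filter fun q : Fin n × Fin n => q.1 < q.2 ∧ b q.1 = b q.2

theorem count (hb : Monotone b) (u w : Equiv.Perm (Fin n)) (hub : ∀ i, b (u i) = b i)
    (hu : ∀ i j, i < j → b i = b j → u j < u i)
    (hw : ∀ i j, i < j → b i = b j → w⁻¹ j < w⁻¹ i) :
    (prs b).card + len n (u * w) + ninv w ≤
      (Finset.univ.filter fun q : Fin n × Fin n => q.1 < q.2).card := by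
  have hui := block_inv b hub
  have hmono : ∀ i j, b i < b j → i < j := by
    intro i j h
    by_contra hc
    exact absurd (hb (not_lt.mp hc)) (not_le.mpr h)
  have h1 : len n (u * w) ≤ (Finset.univ.filter fun q : Fin n × Fin n =>
      q.1 < q.2 ∧ b q.1 ≠ b q.2 ∧ w⁻¹ q.2 < w⁻¹ q.1).card := by
    rw [← len_inv]
    unfold len
    apply Finset.card_le_card_of_injOn (fun q => (u⁻¹ q.1, u⁻¹ q.2))
    · intro q hq
      simp only [Finset.coe_filter, Finset.mem_univ, true_and, Set.mem_ofPred_eq, mul_inv_rev,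
        Equiv.Perm.coe_mul, Function.comp_apply] at hq ⊢
      have hne : b (u⁻¹ q.1) ≠ b (u⁻¹ q.2) := by
        intro he
        rcases lt_trichotomy (u⁻¹ q.1) (u⁻¹ q.2) with h | h | h
        · have := hu _ _ h he
          simp at this
          exact absurd hq.1 (not_lt.mpr this.le)
        · rw [h] at hq; exact absurd hq.2 (lt_irrefl _)
        · exact absurd (hw _ _ h he.symm) (not_lt.mpr hq.2.le)
      refine ⟨?_, hne, hq.2⟩
      apply hmono
      apply lt_of_le_of_ne _ hne
      rw [hui, hui]
      exact hb hq.1.le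
    · intro q _ r _ h
      simp only [Prod.mk.injEq, EmbeddingLike.apply_eq_iff_eq] at h
      exact Prod.ext h.1 h.2
  have h2 : ninv w = (Finset.univ.filter fun q : Fin n × Fin n =>
      q.1 < q.2 ∧ b q.1 ≠ b q.2 ∧ w⁻¹ q.1 < w⁻¹ q.2).card := by
    unfold ninv
    congr 1
    apply Finset.filter_congr
    intro q _
    constructor
    · rintro ⟨h1, h2⟩
      exact ⟨h1, fun he => absurd (hw _ _ h1 he) (not_lt.mpr h2.le), h2⟩
    · rintro ⟨h1, _, h2⟩
      exact ⟨h1, h2⟩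
  rw [h2]
  refine (Nat.add_le_add_right (Nat.add_le_add_left h1 _) _).trans ?_
  unfold prs
  rw [← Finset.card_union_of_disjoint, ← Finset.card_union_of_disjoint]
  · apply Finset.card_le_card
    intro q hq
    simp only [Finset.mem_union, Finset.mem_filter, Finset.mem_univ, true_and] at hq ⊢
    tauto
  · rw [Finset.disjoint_left]
    intro q hq hr
    simp only [Finset.mem_union, Finset.mem_filter, Finset.mem_univ, true_and] at hq hr
    rcases hq with hq | hq
    · exact hr.2.1 hq.2
    · exact absurd hq.2.2 (not_lt.mpr hr.2.2.le)
  · rw [Finset.disjoint_left]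
    intro q hq hr
    simp only [Finset.mem_union, Finset.mem_filter, Finset.mem_univ, true_and] at hq hr
    exact hr.2.1 hq.2

theorem ninv_lt {p : ℕ} (hp : p + 1 < n) (w : Equiv.Perm (Fin n))
    (h : w⁻¹ ⟨p, by omega⟩ < w⁻¹ ⟨p + 1, hp⟩) : ninv (asw hp * w) < ninv w := by
  -- ninv is an `ascN`
  have e : ∀ v : Equiv.Perm (Fin n), ninv v = ascN (fun i => (v⁻¹ i).1) := fun v => rfl
  rw [e, e]
  have := ascN_swap hp (fun i => (w⁻¹ i).1) h
  convert this using 2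
  funext i
  simp only [mul_inv_rev, asw_inv, Function.comp_apply]
  rfl

end blocks
end LSS

open scoped Classical
set_option linter.unusedSimpArgs false
set_option linter.unusedSectionVars false

namespace LSS
open MvPolynomial

theorem mono_mul {n : ℕ} (α β : Fin n → ℕ) : mono n α * mono n β = mono n (α + β) := by
  have h : expOf n α + expOf n β = expOf n (α + β) := by ext i; rfl
  unfold mono
  rw [monomial_mul, one_mul, h]

theorem mono_single {n : ℕ} (a : Fin n) : mono n (Pi.single a 1) = X a := by
  unfold mono X
  congr 1
  ext i
  simp [expOf, Finsupp.single_apply, Pi.single_apply, eq_comm]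

theorem mono_prod {n : ℕ} (β : Fin n → ℕ) : mono n β = ∏ i, X i ^ β i := by
  unfold mono
  rw [monomial_eq, Finsupp.prod_fintype]
  · simp [expOf]
  · simp

theorem expOf_inj {n : ℕ} {α β : Fin n → ℕ} : expOf n α = expOf n β ↔ α = β :=
  Finsupp.equivFunOnFinite.symm.injective.eq_iff

section blocks
variable {n : ℕ} {τ : Type*} [LinearOrder τ] (b : Fin n → τ)

noncomputable def blk : Finset (Equiv.Perm (Fin n)) :=
  Finset.univ.filter fun σ => ∀ i, b (σ i) = b i

theorem mem_blk {σ : Equiv.Perm (Fin n)} : σ ∈ blk b ↔ ∀ i, b (σ i) = b i := by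
  simp [blk]

noncomputable def Alt : MvPolynomial (Fin n) ℤ →ₗ[ℤ] MvPolynomial (Fin n) ℤ :=
  ∑ σ ∈ blk b, (Equiv.Perm.sign σ : ℤ) • (rename (⇑σ)).toLinearMap

theorem Alt_apply (g : MvPolynomial (Fin n) ℤ) :
    Alt b g = ∑ σ ∈ blk b, (Equiv.Perm.sign σ : ℤ) • rename (⇑σ) g := by
  simp [Alt, LinearMap.sum_apply]

theorem Alt_swap {p : ℕ} (hp : p + 1 < n) (hbp : b ⟨p, by omega⟩ = b ⟨p + 1, hp⟩)
    (g : MvPolynomial (Fin n) ℤ) : Alt b (rename (⇑(asw hp)) g) = - Alt b g := by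
  rw [Alt_apply, Alt_apply, ← Finset.sum_neg_distrib]
  have hb' := asw_block b hp hbp
  apply Finset.sum_bij' (fun σ _ => σ * asw hp) (fun σ _ => σ * asw hp)
  · intro σ hσ
    rw [mem_blk] at hσ ⊢
    intro i
    rw [Equiv.Perm.mul_apply, hσ, hb']
  · intro σ hσ
    rw [mem_blk] at hσ ⊢
    intro i
    rw [Equiv.Perm.mul_apply, hσ, hb']
  · intro σ _; rw [mul_assoc, asw_mul_self, mul_one]
  · intro σ _; rw [mul_assoc, asw_mul_self, mul_one]
  · intro σ _
    rw [rename_comm]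
    have : Equiv.Perm.sign (asw hp) = -1 := Equiv.Perm.sign_swap (by simp)
    rw [Equiv.Perm.sign_mul, this]
    simp

theorem Alt_symm_mul (g h : MvPolynomial (Fin n) ℤ)
    (hg : ∀ σ ∈ blk b, rename (⇑σ) g = g) : Alt b (h * g) = g * Alt b h := by
  rw [Alt_apply, Alt_apply, Finset.mul_sum]
  apply Finset.sum_congr rfl
  intro σ hσ
  rw [map_mul, hg σ hσ, mul_smul_comm, mul_comm]

/-- `ρ` drops by one inside blocks -/
def IsRho (ρ : Fin n → ℕ) : Prop :=
  ∀ p (hp : p + 1 < n), b ⟨p, by omega⟩ = b ⟨p + 1, hp⟩ → ρ ⟨p, by omega⟩ = ρ ⟨p + 1, hp⟩ + 1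

theorem A1 {ρ : Fin n → ℕ} (hρ : IsRho b ρ) {p : ℕ} (hp : p + 1 < n)
    (hbp : b ⟨p, by omega⟩ = b ⟨p + 1, hp⟩) (f : MvPolynomial (Fin n) ℤ) :
    Alt b (mono n ρ * dem n (p + 1) f) = Alt b (mono n ρ * f) := by
  set a : Fin n := ⟨p, by omega⟩ with ha
  set c : Fin n := ⟨p + 1, hp⟩ with hc
  have hr := hρ p hp hbp
  rw [← ha, ← hc] at hr
  set H := mono n (fun i => if i = a then ρ c else ρ i) with hH
  have e1 : mono n ρ = X a * H := by
    rw [← mono_single, hH, mono_mul]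
    congr 1
    funext i
    by_cases hi : i = a
    · subst hi; simp [hr]; omega
    · simp [hi]
  have e2 : rename (⇑(asw hp)) H = H := by
    rw [hH, rename_mono, asw_inv]
    congr 1
    funext i
    simp only [Function.comp_apply]
    by_cases h1 : i.1 = p
    · have : i = a := Fin.ext h1
      rw [this, ha, asw_left]; simp [ha, hc]
    · by_cases h2 : i.1 = p + 1
      · have : i = c := Fin.ext h2
        rw [this, hc, asw_right]; simp [ha, hc]
      · rw [asw_of_ne hp i h1 h2]
  have e3 : ∀ g, rename (⇑(asw hp)) (X a * H * g) = X c * H * rename (⇑(asw hp)) g := by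
    intro g
    rw [map_mul, map_mul, e2, rename_X, ha, asw_left]
  have hsym : rename (⇑(asw hp)) (dem n (p + 1) f) = dem n (p + 1) f := dem_symm hp f
  have hspec : (X a - X c) * dem n (p + 1) f = X a * f - X c * rename (⇑(asw hp)) f := dem_spec hp f
  have h1 := Alt_swap b hp hbp (X a * H * dem n (p + 1) f)
  have h2 := Alt_swap b hp hbp (X a * H * f)
  rw [e3] at h1 h2
  rw [hsym] at h1
  have h3 : X a * H * dem n (p + 1) f - X c * H * dem n (p + 1) f =
      X a * H * f - X c * H * rename (⇑(asw hp)) f := by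
    linear_combination H * hspec
  have h4 := congrArg (Alt b) h3
  rw [map_sub, map_sub, h1, h2] at h4
  rw [e1]
  have h5 : (2 : MvPolynomial (Fin n) ℤ) * Alt b (X a * H * dem n (p + 1) f) =
      2 * Alt b (X a * H * f) := by linear_combination h4
  exact mul_left_cancel₀ two_ne_zero h5

theorem A_key_swap {ρ : Fin n → ℕ} (hρ : IsRho b ρ) {p : ℕ} (hp : p + 1 < n)
    (hbp : b ⟨p, by omega⟩ = b ⟨p + 1, hp⟩) (α : Fin n → ℕ) :
    Alt b (mono n ρ * keyPoly n (α ∘ asw hp)) = Alt b (mono n ρ * keyPoly n α) := by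
  rcases le_total (α ⟨p + 1, hp⟩) (α ⟨p, by omega⟩) with h | h
  · rw [← key_up' hp α h, A1 b hρ hp hbp]
  · have h2 := key_up' hp (α ∘ asw hp) (by simpa [asw_left, asw_right] using h)
    have h3 : (α ∘ asw hp) ∘ asw hp = α := by
      funext i; simp [asw_asw]
    rw [h3] at h2
    rw [← A1 b hρ hp hbp, h2]

theorem A_key_block (hb : Monotone b) {ρ : Fin n → ℕ} (hρ : IsRho b ρ) (v w : Equiv.Perm (Fin n))
    (hv : ∀ i, b (v i) = b i) (lam : Fin n → ℕ) :
    Alt b (mono n ρ * keyPoly n (pact n (v * w) lam)) = Alt b (mono n ρ * keyPoly n (pact n w lam)) := by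
  refine block_induct b hb (fun v => Alt b (mono n ρ * keyPoly n (pact n (v * w) lam)) =
    Alt b (mono n ρ * keyPoly n (pact n w lam))) (by simp) ?_ v hv
  intro p hp hbp σ h
  rw [mul_assoc, pact_asw, A_key_swap b hρ hp hbp, h]

theorem key_block_symm (hb : Monotone b) (w : Equiv.Perm (Fin n))
    (hw : ∀ i j, i < j → b i = b j → w⁻¹ j < w⁻¹ i) (lam : Fin n → ℕ) (hl : IsPartition n lam) :
    ∀ σ ∈ blk b, rename (⇑σ) (keyPoly n (pact n w lam)) = keyPoly n (pact n w lam) := by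
  intro σ hσ
  rw [mem_blk] at hσ
  refine block_induct b hb (fun σ => rename (⇑σ) (keyPoly n (pact n w lam)) = keyPoly n (pact n w lam))
    ?_ ?_ σ hσ
  · simp
  · intro p hp hbp σ h
    rw [← rename_comm, h]
    have h1 : pact n w lam ⟨p, by omega⟩ ≤ pact n w lam ⟨p + 1, hp⟩ :=
      hl _ _ (hw _ _ (by simp [Fin.lt_def]) hbp).le
    rw [← key_fix hp _ h1]
    exact dem_symm hp _

/-- main identity -/
theorem key_delta (hb : Monotone b) {ρ : Fin n → ℕ} (hρ : IsRho b ρ) (v w : Equiv.Perm (Fin n))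
    (hv : ∀ i, b (v i) = b i) (hw : ∀ i j, i < j → b i = b j → w⁻¹ j < w⁻¹ i)
    (lam : Fin n → ℕ) (hl : IsPartition n lam) :
    keyPoly n (pact n w lam) * Alt b (mono n ρ) = Alt b (mono n ρ * keyPoly n (pact n (v * w) lam)) := by
  rw [A_key_block b hb hρ v w hv, Alt_symm_mul b _ _ (key_block_symm b hb w hw lam hl)]

end blocks
end LSS

open scoped Classical
set_option linter.unusedSimpArgs false
set_option linter.unusedSectionVars false

namespace LSS
open MvPolynomial

theorem hPoly_zero {n : ℕ} (S : Finset (Fin n)) : hPoly n S 0 = 1 := by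
  unfold hPoly
  rw [Finset.sym_zero, Finset.sum_singleton]
  rfl

theorem hPoly_singleton {n : ℕ} (y : Fin n) (m : ℕ) : hPoly n {y} m = X y ^ m := by
  unfold hPoly
  rw [Finset.sym_singleton, Finset.sum_singleton]
  simp [Sym.replicate]

theorem hPoly_insert {n : ℕ} (S : Finset (Fin n)) (y : Fin n) (hy : y ∉ S) (m : ℕ) :
    hPoly n (insert y S) (m + 1) = hPoly n S (m + 1) + X y * hPoly n (insert y S) m := by
  unfold hPoly
  rw [← Finset.sum_filter_add_sum_filter_not ((insert y S).sym (m + 1)) (fun f => y ∉ f)]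
  congr 1
  · apply Finset.sum_congr _ (fun _ _ => rfl)
    ext f
    simp only [Finset.mem_filter, Finset.mem_sym_iff]
    constructor
    · rintro ⟨h1, h2⟩ a ha
      rcases Finset.mem_insert.mp (h1 a ha) with rfl | h
      · exact absurd ha h2
      · exact h
    · intro h
      exact ⟨fun a ha => Finset.mem_insert_of_mem (h a ha), fun hf => hy (h y hf)⟩
  · rw [Finset.mul_sum]
    symm
    apply Finset.sum_bij (fun f _ => y ::ₛ f)
    · intro f hf
      simp only [Finset.mem_filter, Finset.mem_sym_iff, not_not, Sym.mem_cons] at hf ⊢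
      refine ⟨?_, by simp⟩
      rintro a (rfl | ha)
      · simp
      · exact hf a ha
    · intro f _ g _ h
      exact (Sym.cons_inj_right _ _ _).mp h
    · intro f hf
      simp only [Finset.mem_filter, Finset.mem_sym_iff, not_not] at hf
      obtain ⟨g, rfl⟩ : ∃ g, f = y ::ₛ g := ⟨f.erase y hf.2, (Sym.cons_erase hf.2).symm⟩
      refine ⟨g, ?_, rfl⟩
      rw [Finset.mem_sym_iff]
      intro a ha
      exact hf.1 a (Sym.mem_cons_of_mem ha)
    · intro f hf
      change _ = (Multiset.map X (y ::ₘ (f : Multiset (Fin n)))).prod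
      rw [Multiset.map_cons, Multiset.prod_cons]

theorem hZ_insert {n : ℕ} (S : Finset (Fin n)) (y : Fin n) (hy : y ∉ S) (z : ℤ) :
    hZ n (insert y S) z = hZ n S z + X y * hZ n (insert y S) (z - 1) := by
  unfold hZ
  rcases lt_trichotomy z 0 with h | h | h
  · rw [if_neg (by omega), if_neg (by omega), if_neg (by omega)]; simp
  · subst h
    simp [hPoly_zero]
  · obtain ⟨m, rfl⟩ : ∃ m : ℕ, z = m + 1 := ⟨(z - 1).toNat, by omega⟩
    rw [if_pos (by omega), if_pos (by omega), if_pos (by omega)]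
    have e1 : ((m : ℤ) + 1).toNat = m + 1 := by omega
    have e2 : ((m : ℤ) + 1 - 1).toNat = m := by omega
    rw [e1, e2, hPoly_insert S y hy]

theorem pow_expand {n : ℕ} (i : Fin n) (S : Finset (Fin n)) : i ∉ S →
    ∃ c : ℕ → MvPolynomial (Fin n) ℤ, ∀ m : ℤ, 
      (if 0 ≤ m then X i ^ m.toNat else 0) =
        ∑ l ∈ Finset.range (insert i S).card, c l * hZ n (insert i S) (m - l) := by
  induction S using Finset.induction_on with
  | empty =>
    intro _
    refine ⟨fun _ => 1, fun m => ?_⟩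
    simp [hZ, hPoly_singleton]
  | insert y S hy ih =>
    intro hi
    rw [Finset.mem_insert, not_or] at hi
    obtain ⟨c, hc⟩ := ih hi.2
    have hy' : y ∉ insert i S := by
      rw [Finset.mem_insert, not_or]; exact ⟨fun h => hi.1 h.symm, hy⟩
    set T := insert i S with hT
    have e : insert i (insert y S) = insert y T := Finset.insert_comm _ _ _
    rw [e, Finset.card_insert_of_notMem hy']
    refine ⟨fun l => (if l < T.card then c l else 0) - X y * (if l = 0 then 0 else c (l - 1)), fun m => ?_⟩
    rw [hc m]
    have h1 : ∀ l ∈ Finset.range T.card, c l * hZ n T (m - l) =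
        c l * hZ n (insert y T) (m - l) - X y * (c l * hZ n (insert y T) (m - (l + 1 : ℕ))) := by
      intro l _
      have := hZ_insert T y hy' (m - l)
      have e3 : m - (l : ℤ) - 1 = m - (l + 1 : ℕ) := by push_cast; ring
      rw [e3] at this
      linear_combination -c l * this
    rw [Finset.sum_congr rfl h1, Finset.sum_sub_distrib]
    simp only [sub_mul]
    rw [Finset.sum_sub_distrib, Finset.sum_range_succ, Finset.sum_range_succ' (n := T.card)]
    congr 1
    · simp only [lt_irrefl, if_false, zero_mul, add_zero]
      apply Finset.sum_congr rfl
      intro l hl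
      rw [if_pos (Finset.mem_range.mp hl)]
    · simp only [if_true, mul_zero, zero_mul, add_zero, Nat.add_sub_cancel, Nat.succ_ne_zero, if_false, mul_assoc]

section blocks
variable {n k : ℕ} {d : Fin (k + 2) → ℕ} {b : Fin n → Fin (k + 1)}

/-- `b` is the block labelling -/
def IsLab (d : Fin (k + 2) → ℕ) (b : Fin n → Fin (k + 1)) : Prop :=
  ∀ j : Fin n, d (b j).castSucc ≤ j.1 ∧ j.1 < d (b j).succ

theorem exists_lab (hd : BlockData n k d) : ∃ b : Fin n → Fin (k + 1), IsLab d b := by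
  have : ∀ j : Fin n, ∃ t : Fin (k + 1), d t.castSucc ≤ j.1 ∧ j.1 < d t.succ := by
    intro j
    by_contra hc
    push Not at hc
    have : ∀ t : Fin (k + 2), d t ≤ j.1 := by
      intro t
      induction t using Fin.induction with
      | zero => rw [hd.1]; omega
      | succ t ih => exact hc t ih
    have h2 := this (Fin.last _)
    rw [hd.2.1] at h2
    omega
  choose b hb using this
  exact ⟨b, hb⟩

theorem lab_iff (hd : BlockData n k d) (hb : IsLab d b) (j : Fin n) (t : Fin (k + 1)) :
    b j = t ↔ d t.castSucc ≤ j.1 ∧ j.1 < d t.succ := by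
  constructor
  · rintro rfl; exact hb j
  · rintro ⟨h1, h2⟩
    obtain ⟨h3, h4⟩ := hb j
    have hm := hd.2.2
    have a1 : t.castSucc < (b j).succ := hm.lt_iff_lt.mp (by omega)
    have a2 : (b j).castSucc < t.succ := hm.lt_iff_lt.mp (by omega)
    rw [Fin.lt_def] at a1 a2
    simp at a1 a2
    exact Fin.ext (by omega)

theorem lab_mono (hd : BlockData n k d) (hb : IsLab d b) : Monotone b := by
  intro i j hij
  by_contra hc
  rw [not_le, Fin.lt_def] at hc
  have h1 := (hb j).2
  have h2 := (hb i).1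
  have h3 : d (b j).succ ≤ d (b i).castSucc := hd.2.2.monotone (by rw [Fin.le_def]; simpa using hc)
  rw [Fin.le_def] at hij
  omega

theorem lab_I (hd : BlockData n k d) (hb : IsLab d b) (I : Set ℕ)
    (hID : ∀ m, m ∈ I ↔ (1 ≤ m ∧ m ≤ n - 1 ∧ m ∉ Dset k d)) (p : ℕ) (hp : p + 1 < n) :
    p + 1 ∈ I ↔ b ⟨p, by omega⟩ = b ⟨p + 1, hp⟩ := by
  rw [hID]
  constructor
  · rintro ⟨-, -, h⟩
    rw [lab_iff hd hb]
    obtain ⟨h1, h2⟩ := hb ⟨p + 1, hp⟩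
    simp only at h1 h2 ⊢
    refine ⟨?_, by omega⟩
    by_contra hc
    apply h
    refine ⟨(b ⟨p + 1, hp⟩).castSucc, ?_, ?_, by omega⟩
    · intro h0
      rw [h0, hd.1] at hc
      omega
    · exact (Fin.castSucc_lt_last _).ne
  · intro h
    refine ⟨by omega, by omega, ?_⟩
    rintro ⟨t, -, -, ht⟩
    obtain ⟨h1, h2⟩ := hb ⟨p, by omega⟩
    obtain ⟨h3, h4⟩ := hb ⟨p + 1, hp⟩
    rw [← h] at h3 h4
    simp only at h1 h2 h3 h4
    have a1 : (b ⟨p, by omega⟩).castSucc < t := hd.2.2.lt_iff_lt.mp (by omega)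
    have a2 : t < (b ⟨p, by omega⟩).succ := hd.2.2.lt_iff_lt.mp (by omega)
    rw [Fin.lt_def] at a1 a2
    simp at a1 a2
    omega

/-- the vector rho -/
def rho (d : Fin (k + 2) → ℕ) (b : Fin n → Fin (k + 1)) : Fin n → ℕ := fun j => d (b j).succ - 1 - j.1

theorem rho_isRho (hb : IsLab d b) : IsRho b (rho d b) := by
  intro p hp h
  unfold rho
  rw [h]
  have := (hb ⟨p + 1, hp⟩).2
  simp only at this ⊢
  omega

theorem Alt_det {τ : Type*} [LinearOrder τ] (b : Fin n → τ) (μ : Fin n → ℕ) :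
    Alt b (mono n μ) = (Matrix.of fun i j : Fin n => if b i = b j then
      (X i ^ μ j : MvPolynomial (Fin n) ℤ) else 0).det := by
  rw [Alt_apply, Matrix.det_apply]
  unfold blk
  rw [Finset.sum_filter]
  apply Finset.sum_congr rfl
  intro σ _
  split_ifs with h
  · rw [mono_prod, map_prod]
    rw [Units.smul_def]
    congr 1
    apply Finset.prod_congr rfl
    intro i _
    simp [h i]
  · push Not at h
    obtain ⟨i, hi⟩ := h
    rw [Finset.prod_eq_zero (Finset.mem_univ i)]
    · simp
    · simp [hi]

noncomputable def Hm (d : Fin (k + 2) → ℕ) (b : Fin n → Fin (k + 1)) (β : Fin n → ℕ) :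
    Matrix (Fin n) (Fin n) (MvPolynomial (Fin n) ℤ) :=
  Matrix.of fun l j => if b l = b j then hZ n (blockVars n k d (b j)) ((β j : ℤ) - j.1 + l.1) else 0

theorem Hm_zero : (Hm d b 0).det = 1 := by
  rw [Matrix.det_of_isLowerTriangular]
  · apply Finset.prod_eq_one
    intro i _
    simp [Hm, hZ, hPoly_zero]
  · intro i j hij
    have : i < j := hij
    rw [Fin.lt_def] at this
    simp only [Hm, Matrix.of_apply, hZ, Pi.zero_apply]
    split_ifs <;> first | rfl | (exfalso; omega) | skip

theorem Hm_schur (hd : BlockData n k d) (hb : IsLab d b) (β : Fin n → ℕ) (γ : Fin (k + 1) → ℕ → ℕ)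
    (hγ : ∀ j, β j = γ (b j) (j.1 - d (b j).castSucc + 1)) :
    (Hm d b β).det = dSchur n k d γ := by
  have hbt : (Hm d b β).BlockTriangular b := by
    intro i j hij
    simp only [Hm, Matrix.of_apply]
    rw [if_neg (by intro h; rw [h] at hij; exact lt_irrefl _ hij)]
  rw [hbt.det_fintype]
  unfold dSchur
  apply Finset.prod_congr rfl
  intro t _
  have hdt : d t.castSucc < d t.succ := hd.2.2 (Fin.castSucc_lt_succ)
  have hdn : d t.succ ≤ n := by
    rw [← hd.2.1]; exact hd.2.2.monotone (Fin.le_last _)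
  let e : Fin (d t.succ - d t.castSucc) ≃ {a : Fin n // b a = t} :=
    { toFun := fun i => ⟨⟨d t.castSucc + i.1, by omega⟩, by
        rw [lab_iff hd hb]; simp only; omega⟩
      invFun := fun a => ⟨a.1.1 - d t.castSucc, by
        have := (lab_iff hd hb a.1 t).mp a.2; omega⟩
      left_inv := fun i => by simp
      right_inv := fun a => by
        have := (lab_iff hd hb a.1 t).mp a.2
        apply Subtype.ext
        apply Fin.ext
        simp only
        omega }
  rw [← Matrix.det_submatrix_equiv_self e, ← Matrix.det_transpose]
  unfold schurP
  congr 1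
  ext1 i j
  have e1 : b (e i).1 = t := (e i).2
  have e2 : b (e j).1 = t := (e j).2
  simp only [Matrix.transpose_apply, Matrix.submatrix_apply, Matrix.toSquareBlock_def, Matrix.of_apply, Hm, e1, e2, if_true, hγ]
  congr 1
  simp only [e, Equiv.coe_fn_mk]
  rw [Nat.add_sub_cancel_left]
  push_cast
  ring

theorem jacobi_trudi (hd : BlockData n k d) (hb : IsLab d b) (β : Fin n → ℕ) (γ : Fin (k + 1) → ℕ → ℕ)
    (hγ : ∀ j, β j = γ (b j) (j.1 - d (b j).castSucc + 1)) :
    Alt b (mono n (rho d b + β)) = Alt b (mono n (rho d b)) * dSchur n k d γ := by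
  have hmem : ∀ i, i ∈ blockVars n k d (b i) := fun i => by
    simp [blockVars, (hb i).1, (hb i).2]
  have hcard : ∀ t : Fin (k + 1), (blockVars n k d t).card = d t.succ - d t.castSucc := by
    intro t
    have hdn : d t.succ ≤ n := by
      rw [← hd.2.1]; exact hd.2.2.monotone (Fin.le_last _)
    rw [← Nat.card_Ico, ← Finset.card_map Fin.valEmbedding]
    congr 1
    ext x
    simp only [blockVars, Finset.mem_map, Finset.mem_filter, Finset.mem_univ, true_and, Finset.mem_Ico,
      Fin.valEmbedding_apply]
    constructor
    · rintro ⟨a, h, rfl⟩; exact h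
    · intro h; exact ⟨⟨x, by omega⟩, h, rfl⟩
  have hex : ∀ i, ∃ c : ℕ → MvPolynomial (Fin n) ℤ, ∀ m : ℤ, 
      (if 0 ≤ m then X i ^ m.toNat else 0) =
        ∑ l ∈ Finset.range (blockVars n k d (b i)).card, c l * hZ n (blockVars n k d (b i)) (m - l) := by
    intro i
    have := pow_expand i ((blockVars n k d (b i)).erase i) (by simp)
    rwa [Finset.insert_erase (hmem i)] at this
  choose c hc using hex
  let C : Matrix (Fin n) (Fin n) (MvPolynomial (Fin n) ℤ) :=
    Matrix.of fun i l => if b i = b l then c i (rho d b l) else 0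
  have hfac : ∀ β : Fin n → ℕ, Alt b (mono n (rho d b + β)) = C.det * (Hm d b β).det := by
    intro β
    rw [Alt_det, ← Matrix.det_mul]
    congr 1
    ext1 i j
    rw [Matrix.mul_apply]
    simp only [Matrix.of_apply, C, Hm]
    by_cases hij : b i = b j
    · rw [if_pos hij]
      have h1 := hc i ((rho d b + β) j : ℕ)
      rw [if_pos (by positivity), Int.toNat_natCast] at h1
      rw [h1, hcard]
      rw [← Finset.sum_filter_add_sum_filter_not Finset.univ (fun l => b l = b i)]
      rw [Finset.sum_eq_zero (s := Finset.univ.filter fun l => ¬ b l = b i), add_zero]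
      · symm
        apply Finset.sum_bij (fun l _ => rho d b l)
        · intro l hl
          simp only [Finset.mem_filter, Finset.mem_univ, true_and] at hl
          have := hb l
          rw [hl] at this
          rw [Finset.mem_range]
          unfold rho
          rw [hl]
          omega
        · intro l hl l' hl' h
          simp only [Finset.mem_filter, Finset.mem_univ, true_and] at hl hl'
          have h1 := hb l
          have h2 := hb l'
          unfold rho at h
          rw [hl] at h1 h
          rw [hl'] at h2 h
          apply Fin.ext
          omega
        · intro r hr
          rw [Finset.mem_range] at hr
          have hdn : d (b i).succ ≤ n := by
            rw [← hd.2.1]; exact hd.2.2.monotone (Fin.le_last _)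
          have hl : b ⟨d (b i).succ - 1 - r, by omega⟩ = b i := by
            rw [lab_iff hd hb]; simp only; omega
          refine ⟨⟨d (b i).succ - 1 - r, by omega⟩, ?_, ?_⟩
          · simp [hl]
          · unfold rho; rw [hl]; simp only; omega
        · intro l hl
          simp only [Finset.mem_filter, Finset.mem_univ, true_and] at hl
          rw [if_pos hl.symm, if_pos (by rw [hl, hij]), hij]
          congr 2
          have h1 := hb l
          have h2 := hb j
          rw [hl] at h1
          rw [← hij] at h2
          simp only [Pi.add_apply, rho]
          rw [hl, ← hij]
          omega
      · intro l hl
        simp only [Finset.mem_filter, Finset.mem_univ, true_and] at hl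
        rw [if_neg (fun h => hl h.symm), zero_mul]
    · rw [if_neg hij]
      symm
      apply Finset.sum_eq_zero
      intro l _
      split_ifs with h1 h2
      · exact absurd (h1.trans h2) hij
      · simp
      · simp
      · simp
  have h0 := hfac 0
  rw [Hm_zero, mul_one, add_zero] at h0
  rw [hfac, h0, Hm_schur hd hb β γ hγ]

end blocks
end LSS

open scoped Classical
set_option linter.unusedSimpArgs false
set_option linter.unusedSectionVars false

namespace LSS
open MvPolynomial

section blocks
variable {n k : ℕ} {d : Fin (k + 2) → ℕ} {b : Fin n → Fin (k + 1)}

theorem delta_prod (hd : BlockData n k d) (hb : IsLab d b) :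
    Alt b (mono n (rho d b)) = ∏ q ∈ prs b, (X q.1 - X q.2) := by
  rw [Alt_det]
  have hbt : (Matrix.of fun i j : Fin n => if b i = b j then
      (X i ^ (rho d b) j : MvPolynomial (Fin n) ℤ) else 0).BlockTriangular b := by
    intro i j hij
    simp only [Matrix.of_apply]
    rw [if_neg (by intro h; rw [h] at hij; exact lt_irrefl _ hij)]
  rw [hbt.det_fintype, ← Finset.prod_fiberwise (prs b) (fun q => b q.1)]
  apply Finset.prod_congr rfl
  intro t _
  have hdt : d t.castSucc < d t.succ := hd.2.2 (Fin.castSucc_lt_succ)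
  have hdn : d t.succ ≤ n := by
    rw [← hd.2.1]; exact hd.2.2.monotone (Fin.le_last _)
  let e : Fin (d t.succ - d t.castSucc) ≃ {a : Fin n // b a = t} :=
    { toFun := fun i => ⟨⟨d t.castSucc + i.1, by omega⟩, by
        rw [lab_iff hd hb]; simp only; omega⟩
      invFun := fun a => ⟨a.1.1 - d t.castSucc, by
        have := (lab_iff hd hb a.1 t).mp a.2; omega⟩
      left_inv := fun i => by simp
      right_inv := fun a => by
        have := (lab_iff hd hb a.1 t).mp a.2
        apply Subtype.ext
        apply Fin.ext
        simp only
        omega }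
  rw [← Matrix.det_submatrix_equiv_self e]
  have h1 := Matrix.det_projVandermonde (fun _ => (1 : MvPolynomial (Fin n) ℤ)) (fun i => X (e i).1)
  have h2 : (Matrix.projVandermonde (fun _ => (1 : MvPolynomial (Fin n) ℤ)) (fun i => X (e i).1)) =
      Matrix.submatrix (((Matrix.of fun i j : Fin n => if b i = b j then
      (X i ^ (rho d b) j : MvPolynomial (Fin n) ℤ) else 0)).toSquareBlock b t) ⇑e ⇑e := by
    ext1 i j
    have e1 : b (e i).1 = t := (e i).2
    have e2 : b (e j).1 = t := (e j).2
    rw [Matrix.projVandermonde_apply]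
    simp only [Matrix.submatrix_apply, Matrix.toSquareBlock_def, Matrix.of_apply, e1, e2, if_true,
      one_pow, one_mul]
    congr 1
    unfold rho
    rw [e2]
    have := j.2
    simp only [e, Equiv.coe_fn_mk, Fin.rev, Fin.val_mk]
    omega
  rw [← h2, h1, Finset.prod_sigma']
  apply Finset.prod_bij (fun q _ => ((e q.1).1, (e q.2).1))
  · intro q hq
    have e1 : b (e q.1).1 = t := (e q.1).2
    have e2 : b (e q.2).1 = t := (e q.2).2
    simp only [Finset.mem_sigma, Finset.mem_Ioi, Finset.mem_univ, true_and, Fin.lt_def] at hq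
    simp only [prs, Finset.mem_filter, Finset.mem_univ, true_and, e1, e2, and_true]
    simp only [e, Equiv.coe_fn_mk, Fin.lt_def]
    omega
  · intro q _ q' _ h
    simp only [Prod.mk.injEq] at h
    have a1 := e.injective (Subtype.ext h.1)
    have a2 := e.injective (Subtype.ext h.2)
    cases q; cases q'
    simp only at a1 a2
    rw [a1, a2]
  · intro q hq
    simp only [prs, Finset.mem_filter, Finset.mem_univ, true_and] at hq
    refine ⟨⟨e.symm ⟨q.1, hq.2⟩, e.symm ⟨q.2, by rw [← hq.1.2, hq.2]⟩⟩, ?_, ?_⟩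
    · have h1 := hq.1.1
      have h3 := (lab_iff hd hb q.1 t).mp hq.2
      simp only [Finset.mem_sigma, Finset.mem_Ioi, Finset.mem_univ, true_and, Fin.lt_def] at h1 ⊢
      simp only [e, Equiv.coe_fn_symm_mk]
      omega
    · simp
  · intro q _
    simp

theorem delta_ne (hd : BlockData n k d) (hb : IsLab d b) : Alt b (mono n (rho d b)) ≠ 0 := by
  rw [delta_prod hd hb, Finset.prod_ne_zero_iff]
  intro q hq
  simp only [prs, Finset.mem_filter, Finset.mem_univ, true_and] at hq
  exact XX_ne hq.1.ne

end blocks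
end LSS

open scoped Classical
set_option linter.unusedSimpArgs false
set_option linter.unusedSectionVars false

namespace LSS
open MvPolynomial

theorem X_pow_mono {n : ℕ} (a : Fin n) (m : ℕ) : X a ^ m = mono n (Pi.single a m) := by
  rw [mono_prod, Finset.prod_eq_single a]
  · simp
  · intro i _ hi; simp [Pi.single_apply, hi]
  · simp

theorem dem_mono {n p : ℕ} (hp : p + 1 < n) (β : Fin n → ℕ)
    (h : β ⟨p + 1, hp⟩ ≤ β ⟨p, by omega⟩) :
    dem n (p + 1) (mono n β) = ∑ t ∈ Finset.range (β ⟨p, by omega⟩ - β ⟨p + 1, hp⟩ + 1),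
      mono n (fun j => if j.1 = p then β j - t else if j.1 = p + 1 then β j + t else β j) := by
  set a : Fin n := ⟨p, by omega⟩ with ha
  set c : Fin n := ⟨p + 1, hp⟩ with hc
  set D := β a - β c with hD
  set H := mono n (fun j => if j = a then β c else β j) with hH
  have hac : a ≠ c := by simp [ha, hc]
  have e1 : mono n β = H * X a ^ D := by
    rw [X_pow_mono, mono_mul]
    congr 1
    funext i
    by_cases hi : i = a
    · subst hi; simp; omega
    · simp [hi]
  have e2 : rename (⇑(asw hp)) (mono n β) = H * X c ^ D := by
    rw [rename_mono, asw_inv, X_pow_mono, mono_mul]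
    congr 1
    funext i
    simp only [Function.comp_apply, Pi.add_apply]
    by_cases h1 : i = a
    · rw [h1, ha, asw_left, ← ha, ← hc]; simp [hac]
    · by_cases h2 : i = c
      · rw [h2, hc, asw_right, ← ha, ← hc]; simp [hac.symm]; omega
      · rw [asw_of_ne hp i (fun h => h1 (Fin.ext h)) (fun h => h2 (Fin.ext h))]
        simp [h1, h2]
  have e3 : ∀ t ∈ Finset.range (D + 1),
      mono n (fun j => if j.1 = p then β j - t else if j.1 = p + 1 then β j + t else β j) =
      H * (X c ^ t * X a ^ (D + 1 - 1 - t)) := by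
    intro t ht
    rw [Finset.mem_range] at ht
    rw [X_pow_mono, X_pow_mono, mono_mul, mono_mul]
    congr 1
    funext i
    simp only [Pi.add_apply]
    by_cases h1 : i = a
    · have : i.1 = p := by rw [h1]
      rw [if_pos this, h1]; simp [hac]; omega
    · by_cases h2 : i = c
      · have : i.1 = p + 1 := by rw [h2]
        rw [if_neg (by omega), if_pos this, h2]; simp [hac.symm]
      · rw [if_neg (fun h => h1 (Fin.ext h)), if_neg (fun h => h2 (Fin.ext h))]
        simp [h1, h2]
  apply dem_unique hp
  rw [Finset.sum_congr rfl e3, ← Finset.mul_sum]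
  change (X a - X c) * _ = X a * mono n β - X c * rename (⇑(asw hp)) (mono n β)
  rw [e1] at e2 ⊢
  rw [e2]
  have := geom_sum₂_mul (X c) (X a : MvPolynomial (Fin n) ℤ) (D + 1)
  linear_combination -H * this

theorem word_fix {n : ℕ} (i : ℕ) (L : List ℕ) : (∀ j ∈ L, 1 ≤ j ∧ j ≤ n - 1) → i ∉ L →
    ∀ x : Fin n, ((L.map (st n)).prod x).1 < i ↔ x.1 < i := by
  induction L with
  | nil => intro _ _ x; simp
  | cons a L ih =>
    intro h hi x
    rw [List.mem_cons, not_or] at hi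
    obtain ⟨h1, h2⟩ := h a (by simp)
    obtain ⟨p, rfl⟩ : ∃ p, a = p + 1 := ⟨a - 1, by omega⟩
    have hp : p + 1 < n := by omega
    rw [List.map_cons, List.prod_cons, st_eq hp, Equiv.Perm.mul_apply,
      ← ih (fun j hj => h j (by simp [hj])) hi.2 x, asw_val]
    have := hi.1
    split_ifs <;> omega

theorem key_nodup {n : ℕ} (lam : Fin n → ℕ) (hl : IsPartition n lam) (L : List ℕ) : L.Nodup →
    (∀ j ∈ L, 1 ≤ j ∧ j ≤ n - 1) →
    keyPoly n (pact n (L.map (st n)).prod lam) = demWord n L (mono n lam) := by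
  induction L with
  | nil =>
    intro _ _
    exact keyPoly_dec _ (fun p hp => hl _ _ (by simp [Fin.le_def]))
  | cons a L ih =>
    intro hn h
    rw [List.nodup_cons] at hn
    obtain ⟨h1, h2⟩ := h a (by simp)
    obtain ⟨p, rfl⟩ : ∃ p, a = p + 1 := ⟨a - 1, by omega⟩
    have hp : p + 1 < n := by omega
    have hL : ∀ j ∈ L, 1 ≤ j ∧ j ≤ n - 1 := fun j hj => h j (by simp [hj])
    change _ = dem n (p + 1) (demWord n L (mono n lam))
    rw [← ih hn.2 hL, List.map_cons, List.prod_cons, st_eq hp, pact_asw, key_up' hp]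
    apply hl
    have a1 := word_fix (p + 1) L hL hn.1 ((L.map (st n)).prod⁻¹ ⟨p, by omega⟩)
    have a2 := word_fix (p + 1) L hL hn.1 ((L.map (st n)).prod⁻¹ ⟨p + 1, hp⟩)
    rw [pai] at a1 a2
    simp only at a1 a2
    rw [Fin.le_def]
    omega

/-- the gap `λ_{i-1} - λ_i` -/
def gp (n : ℕ) (lam : Fin n → ℕ) (i : ℕ) : ℕ := ent n lam (i - 1) - ent n lam i

def CondR (n : ℕ) (lam : Fin n → ℕ) (L : List ℕ) (a : ℕ → ℕ) : Prop :=
  (∀ i, i ∉ L → a i = 0) ∧ ∀ i ∈ L, a i ≤ gp n lam i +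
    ((if L.idxOf i < L.idxOf (i - 1) then a (i - 1) else 0) +
    (if L.idxOf i < L.idxOf (i + 1) then a (i + 1) else 0))

theorem condR_cons {n : ℕ} (lam : Fin n → ℕ) (L : List ℕ) (i : ℕ) (hi : i ∉ L) (h1 : 1 ≤ i)
    (a : ℕ → ℕ) : CondR n lam (i :: L) a ↔ CondR n lam L (Function.update a i 0) ∧
      a i ≤ gp n lam i + (a (i - 1) + a (i + 1)) := by
  have hne : ∀ j, j ≠ i → (i :: L).idxOf j = L.idxOf j + 1 := by
    intro j hj
    exact List.idxOf_cons_ne _ (fun h => hj h.symm)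
  have hself : (i :: L).idxOf i = 0 := List.idxOf_cons_self
  have key : ∀ j ∈ L, ∀ m, (if (i :: L).idxOf j < (i :: L).idxOf m then a m else 0) =
      (if L.idxOf j < L.idxOf m then Function.update a i 0 m else 0) := by
    intro j hj m
    have hji : j ≠ i := fun h => hi (h ▸ hj)
    by_cases hm : m = i
    · rw [hm, hself, Function.update_self]; simp
    · rw [hne j hji, hne m hm, Function.update_of_ne hm]
      simp
  unfold CondR
  constructor
  · rintro ⟨h2, h3⟩
    refine ⟨⟨?_, ?_⟩, ?_⟩
    · intro j hj
      by_cases h : j = i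
      · rw [h, Function.update_self]
      · rw [Function.update_of_ne h]
        exact h2 j (by simp [h, hj])
    · intro j hj
      have hji : j ≠ i := fun h => hi (h ▸ hj)
      have := h3 j (by simp [hj])
      rw [key j hj, key j hj] at this
      rw [Function.update_of_ne hji]
      exact this
    · have := h3 i (by simp)
      rw [hself, hne (i - 1) (by omega), hne (i + 1) (by omega)] at this
      simpa using this
  · rintro ⟨⟨h2, h3⟩, h4⟩
    refine ⟨?_, ?_⟩
    · intro j hj
      rw [List.mem_cons, not_or] at hj
      have := h2 j hj.2
      rwa [Function.update_of_ne hj.1] at this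
    · intro j hj
      rw [List.mem_cons] at hj
      rcases hj with rfl | hj
      · rw [hself, hne (j - 1) (by omega), hne (j + 1) (by omega)]
        simpa using h4
      · have hji : j ≠ i := fun h => hi (h ▸ hj)
        have := h3 j hj
        rw [Function.update_of_ne hji] at this
        rw [key j hj, key j hj]
        exact this

/-- the exponent attached to `a` -/
def bet (n : ℕ) (lam : Fin n → ℕ) (a : ℕ → ℕ) : Fin n → ℕ := fun j => lam j + a j.1 - a (j.1 + 1)

theorem expansion {n : ℕ} (lam : Fin n → ℕ) (hl : IsPartition n lam) (L : List ℕ) : L.Nodup →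
    (∀ j ∈ L, 1 ≤ j ∧ j ≤ n - 1) →
    ∃ S : Finset (ℕ → ℕ), (∀ a, a ∈ S ↔ CondR n lam L a) ∧
      (∀ a ∈ S, ∀ j : Fin n, a (j.1 + 1) ≤ lam j + a j.1) ∧
      demWord n L (mono n lam) = ∑ a ∈ S, mono n (bet n lam a) := by
  induction L with
  | nil =>
    intro _ _
    refine ⟨{0}, ?_, ?_, ?_⟩
    · intro a
      simp only [Finset.mem_singleton, CondR, List.not_mem_nil, not_false_eq_true, true_imp_iff,
        false_imp_iff, implies_true, and_true]
      exact funext_iff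
    · intro a ha j
      rw [Finset.mem_singleton] at ha
      subst ha; simp
    · rw [Finset.sum_singleton]
      rfl
  | cons i L ih =>
    intro hn h
    rw [List.nodup_cons] at hn
    obtain ⟨h1, h2⟩ := h i (by simp)
    have hL : ∀ j ∈ L, 1 ≤ j ∧ j ≤ n - 1 := fun j hj => h j (by simp [hj])
    obtain ⟨S, hS, hnn, hsum⟩ := ih hn.2 hL
    obtain ⟨p, rfl⟩ : ∃ p, i = p + 1 := ⟨i - 1, by omega⟩
    have hp : p + 1 < n := by omega
    have hp0 : p < n := by omega
    have hzero : ∀ a ∈ S, a (p + 1) = 0 := fun a ha => ((hS a).mp ha).1 _ hn.1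
    have hg : gp n lam (p + 1) = lam ⟨p, by omega⟩ - lam ⟨p + 1, hp⟩ := by
      unfold gp ent
      rw [dif_pos hp, dif_pos (by omega)]
      rfl
    have hlp : lam ⟨p + 1, hp⟩ ≤ lam ⟨p, by omega⟩ := hl _ _ (by simp [Fin.le_def])
    let N : (ℕ → ℕ) → ℕ := fun a => gp n lam (p + 1) + (a p + a (p + 1 + 1))
    let S' : Finset (ℕ → ℕ) :=
      (S.sigma fun a => Finset.range (N a + 1)).image fun q => Function.update q.1 (p + 1) q.2
    have hS' : ∀ a, a ∈ S' ↔ CondR n lam ((p + 1) :: L) a := by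
      intro a
      rw [condR_cons lam L (p + 1) hn.1 (by omega), ← hS]
      simp only [S', Finset.mem_image, Finset.mem_sigma, Finset.mem_range]
      constructor
      · rintro ⟨⟨a', t⟩, ⟨h3, h4⟩, rfl⟩
        simp only at h3 h4 ⊢
        have : Function.update (Function.update a' (p + 1) t) (p + 1) 0 = a' := by
          rw [Function.update_idem]
          have := hzero a' h3
          rw [← this, Function.update_eq_self]
        rw [this]
        refine ⟨h3, ?_⟩
        rw [Function.update_self, Function.update_of_ne (by omega), Function.update_of_ne (by omega)]
        simp only [N] at h4
        simp only [Nat.add_sub_cancel]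
        omega
      · rintro ⟨h3, h4⟩
        refine ⟨⟨Function.update a (p + 1) 0, a (p + 1)⟩, ⟨h3, ?_⟩, ?_⟩
        · simp only [N]
          rw [Function.update_of_ne (by omega), Function.update_of_ne (by omega)]
          simp only [Nat.add_sub_cancel] at h4
          omega
        · simp
    refine ⟨S', hS', ?_, ?_⟩
    · intro a ha j
      simp only [S', Finset.mem_image, Finset.mem_sigma, Finset.mem_range] at ha
      obtain ⟨⟨a', t⟩, ⟨h3, h4⟩, rfl⟩ := ha
      simp only at h3 h4 ⊢
      have a1 := hnn a' h3 j
      have a2 := hnn a' h3 ⟨p + 1, hp⟩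
      have a3 := hzero a' h3
      simp only [N, hg] at h4
      simp only at a2
      by_cases e1 : j.1 = p
      · have e1' : j = ⟨p, hp0⟩ := Fin.ext e1
        subst e1'
        simp only
        rw [Function.update_self, Function.update_of_ne (by omega)]
        omega
      · by_cases e2 : j.1 = p + 1
        · rw [Function.update_of_ne (by omega), e2, Function.update_self]
          rw [e2] at a1
          omega
        · rw [Function.update_of_ne (by omega), Function.update_of_ne (by omega)]
          exact a1
    · change dem n (p + 1) (demWord n L (mono n lam)) = _
      rw [hsum, dem_sum hp]
      simp only [S']
      rw [Finset.sum_image]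
      · rw [Finset.sum_sigma]
        apply Finset.sum_congr rfl
        intro a ha
        have a1 := hnn a ha ⟨p, by omega⟩
        have a2 := hnn a ha ⟨p + 1, hp⟩
        have a3 := hzero a ha
        simp only at a1 a2
        have b1 : bet n lam a ⟨p, by omega⟩ = lam ⟨p, by omega⟩ + a p := by
          simp [bet, a3]
        have b2 : bet n lam a ⟨p + 1, hp⟩ = lam ⟨p + 1, hp⟩ - a (p + 1 + 1) := by
          simp [bet, a3]
        rw [dem_mono hp _ (by omega)]
        apply Finset.sum_congr
        · rw [b1, b2]
          congr 1
          simp only [N, hg]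
          rw [a3] at a2
          omega
        · intro t ht
          congr 1
          funext j
          unfold bet
          by_cases e1 : j.1 = p
          · have e1' : j = ⟨p, hp0⟩ := Fin.ext e1
            subst e1'
            simp only [if_true]
            rw [Function.update_self, Function.update_of_ne (by omega), a3]
            omega
          · by_cases e2 : j.1 = p + 1
            · have e2' : j = ⟨p + 1, hp⟩ := Fin.ext e2
              subst e2'
              simp only
              rw [if_neg (by omega), if_pos trivial, Function.update_self, Function.update_of_ne (by omega), a3]
              rw [a3] at a2
              omega
            · rw [if_neg e1, if_neg e2, Function.update_of_ne (by omega), Function.update_of_ne (by omega)]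
      · rintro ⟨a, t⟩ h3 ⟨a', t'⟩ h4 heq
        simp only [Finset.coe_sigma, Set.mem_sigma_iff, Finset.mem_coe] at h3 h4 heq
        have c1 : t = t' := by
          have := congrFun heq (p + 1)
          simpa using this
        have c2 : a = a' := by
          funext m
          by_cases hm : m = p + 1
          · rw [hm, hzero a h3.1, hzero a' h4.1]
          · have := congrFun heq m
            rwa [Function.update_of_ne hm, Function.update_of_ne hm] at this
        subst c1 c2
        rfl

end LSS

open scoped Classical
set_option linter.unusedSimpArgs false
set_option linter.unusedSectionVars false

namespace LSS
open MvPolynomial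

/-- early neighbours -/
def eS (L : List ℕ) (a : ℕ → ℕ) (i : ℕ) : ℕ :=
  (if L.idxOf (i - 1) < L.idxOf i then a (i - 1) else 0) +
    (if L.idxOf (i + 1) < L.idxOf i then a (i + 1) else 0)

theorem idx_ne {L : List ℕ} {i j : ℕ} (hi : i ∈ L) (h : i ≠ j) : L.idxOf i ≠ L.idxOf j :=
  fun he => h ((List.idxOf_inj hi).mp he)

theorem cond_split {n : ℕ} {lam : Fin n → ℕ} {L : List ℕ} {a : ℕ → ℕ} (h : CondR n lam L a)
    {i : ℕ} (hi : i ∈ L) (h1 : 1 ≤ i) : a i + eS L a i ≤ gp n lam i + (a (i - 1) + a (i + 1)) := by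
  have h2 := h.2 i hi
  have n1 := idx_ne hi (j := i - 1) (by omega)
  have n2 := idx_ne hi (j := i + 1) (by omega)
  unfold eS
  split_ifs at h2 ⊢ <;> omega

def flip (n : ℕ) (lam : Fin n → ℕ) (i : ℕ) (a : ℕ → ℕ) : ℕ → ℕ :=
  Function.update a i (gp n lam i + (a (i - 1) + a (i + 1)) + 1 - a i)

theorem flip_ne {n : ℕ} {lam : Fin n → ℕ} {i j : ℕ} {a : ℕ → ℕ} (h : j ≠ i) :
    flip n lam i a j = a j := Function.update_of_ne h _ _

theorem flip_self {n : ℕ} {lam : Fin n → ℕ} {i : ℕ} {a : ℕ → ℕ} :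
    flip n lam i a i = gp n lam i + (a (i - 1) + a (i + 1)) + 1 - a i := Function.update_self _ _ _

theorem flip_eS {n : ℕ} {lam : Fin n → ℕ} {L : List ℕ} {i : ℕ} {a : ℕ → ℕ} (h1 : 1 ≤ i) (j : ℕ) (hj : 1 ≤ j)
    (hji : L.idxOf j ≤ L.idxOf i) : eS L (flip n lam i a) j = eS L a j := by
  unfold eS
  congr 1
  · by_cases h : j - 1 = i
    · rw [h, if_neg (by omega), if_neg (by omega)]
    · rw [flip_ne h]
  · by_cases h : j + 1 = i
    · rw [h, if_neg (by omega), if_neg (by omega)]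
    · rw [flip_ne h]

theorem flip_cond {n : ℕ} {lam : Fin n → ℕ} {L : List ℕ} (hL : ∀ j ∈ L, 1 ≤ j ∧ j ≤ n - 1)
    {a : ℕ → ℕ} (h : CondR n lam L a) {i : ℕ} (hi : i ∈ L) (hE : ¬ a i ≤ eS L a i) :
    CondR n lam L (flip n lam i a) ∧ ¬ flip n lam i a i ≤ eS L (flip n lam i a) i := by
  have h1 := (hL i hi).1
  have hs := cond_split h hi h1
  have n1 := idx_ne hi (j := i - 1) (by omega)
  have n2 := idx_ne hi (j := i + 1) (by omega)
  refine ⟨⟨?_, ?_⟩, ?_⟩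
  · intro j hj
    have : j ≠ i := fun e => hj (e ▸ hi)
    rw [flip_ne this]
    exact h.1 j hj
  · intro j hj
    have hj1 := (hL j hj).1
    by_cases hji : j = i
    · subst hji
      rw [flip_self, flip_ne (by omega), flip_ne (by omega)]
      unfold eS at hE
      split_ifs at hE ⊢ <;> omega
    · have h2 := h.2 j hj
      rw [flip_ne hji]
      -- the neighbours
      have n3 := idx_ne hi (j := j) (fun e => hji e.symm)
      have key : j + 1 = i ∨ j - 1 = i → L.idxOf j < L.idxOf i → a j < flip n lam i a i := by
        intro h3 h4
        rw [flip_self]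
        have : a j ≤ eS L a i := by
          unfold eS
          rcases h3 with h3 | h3
          · have : i - 1 = j := by omega
            rw [this, if_pos h4]; omega
          · have : i + 1 = j := by omega
            rw [this, if_pos h4]; omega
        omega
      by_cases e1 : j - 1 = i
      · by_cases hlt : L.idxOf j < L.idxOf i
        · have := key (Or.inr e1) hlt
          rw [e1, if_pos hlt]; omega
        · rw [e1, if_neg hlt] at h2 ⊢
          rw [flip_ne (by omega)]; exact h2
      · by_cases e2 : j + 1 = i
        · by_cases hlt : L.idxOf j < L.idxOf i
          · have := key (Or.inl e2) hlt
            rw [e2, if_pos hlt]; omega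
          · rw [e2, if_neg hlt] at h2 ⊢
            rw [flip_ne e1]; exact h2
        · rw [flip_ne e1, flip_ne e2]; exact h2
  · rw [flip_eS h1 i h1 le_rfl, flip_self]
    have h2 := h.2 i hi
    unfold eS at hE ⊢
    split_ifs at hE h2 ⊢ <;> omega

theorem flip_flip {n : ℕ} {lam : Fin n → ℕ} {L : List ℕ} (hL : ∀ j ∈ L, 1 ≤ j ∧ j ≤ n - 1)
    {a : ℕ → ℕ} (h : CondR n lam L a) {i : ℕ} (hi : i ∈ L) :
    flip n lam i (flip n lam i a) = a := by
  have h1 := (hL i hi).1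
  have hs := cond_split h hi h1
  funext j
  by_cases hj : j = i
  · subst hj
    rw [flip_self, flip_self, flip_ne (by omega), flip_ne (by omega)]
    omega
  · rw [flip_ne hj, flip_ne hj]

section main
variable {n : ℕ} {τ : Type*} [LinearOrder τ] {b : Fin n → τ} {ρ : Fin n → ℕ}

theorem flip_sign (hρ : IsRho b ρ) {lam : Fin n → ℕ} (hl : IsPartition n lam) {a : ℕ → ℕ} {p : ℕ} (hp : p + 1 < n)
    (hbp : b ⟨p, by omega⟩ = b ⟨p + 1, hp⟩)
    (hn : ∀ j : Fin n, a (j.1 + 1) ≤ lam j + a j.1)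
    (hn2 : ∀ j : Fin n, flip n lam (p + 1) a (j.1 + 1) ≤ lam j + flip n lam (p + 1) a j.1)
    (hle : a (p + 1) ≤ gp n lam (p + 1) + (a p + a (p + 1 + 1))) :
    Alt b (mono n (ρ + bet n lam (flip n lam (p + 1) a))) = - Alt b (mono n (ρ + bet n lam a)) := by
  rw [← Alt_swap b hp hbp, rename_mono, asw_inv]
  congr 2
  have hr := hρ p hp hbp
  have hp0 : p < n := by omega
  have hlp : lam ⟨p + 1, hp⟩ ≤ lam ⟨p, hp0⟩ := hl _ _ (by simp [Fin.le_def])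
  have hg : gp n lam (p + 1) = lam ⟨p, by omega⟩ - lam ⟨p + 1, hp⟩ := by
    unfold gp ent
    rw [dif_pos hp, dif_pos (by omega)]
    rfl
  have a1 := hn ⟨p, hp0⟩
  have a2 := hn ⟨p + 1, hp⟩
  have a3 := hn2 ⟨p, hp0⟩
  have a4 := hn2 ⟨p + 1, hp⟩
  simp only at a1 a2 a3 a4
  rw [flip_self, flip_ne (by omega)] at a3
  rw [flip_self, flip_ne (by omega)] at a4
  simp only [Nat.add_sub_cancel] at a3 a4
  funext j
  simp only [Function.comp_apply, Pi.add_apply, bet]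
  by_cases e1 : j.1 = p
  · have e1' : j = ⟨p, hp0⟩ := Fin.ext e1
    subst e1'
    rw [asw_left]
    simp only
    rw [flip_self, flip_ne (by omega)]
    simp only [Nat.add_sub_cancel]
    omega
  · by_cases e2 : j.1 = p + 1
    · have e2' : j = ⟨p + 1, hp⟩ := Fin.ext e2
      subst e2'
      rw [asw_right]
      simp only
      rw [flip_self, flip_ne (by omega)]
      simp only [Nat.add_sub_cancel]
      omega
    · rw [asw_of_ne hp j e1 e2, flip_ne (by omega), flip_ne (by omega)]

theorem cancel (hρ : IsRho b ρ) {lam : Fin n → ℕ} (hl : IsPartition n lam) {L : List ℕ} (hnd : L.Nodup)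
    (hL : ∀ j ∈ L, 1 ≤ j ∧ j ≤ n - 1) (I : Set ℕ)
    (hIb : ∀ p (hp : p + 1 < n), p + 1 ∈ I ↔ b ⟨p, by omega⟩ = b ⟨p + 1, hp⟩)
    (S : Finset (ℕ → ℕ)) (hS : ∀ a, a ∈ S ↔ CondR n lam L a)
    (hn : ∀ a ∈ S, ∀ j : Fin n, a (j.1 + 1) ≤ lam j + a j.1) (s : ℕ) :
    ∑ a ∈ S, Alt b (mono n (ρ + bet n lam a)) =
      ∑ a ∈ S.filter (fun a => ∀ i ∈ L, i ∈ I → L.idxOf i < s → a i ≤ eS L a i),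
        Alt b (mono n (ρ + bet n lam a)) := by
  induction s with
  | zero => simp
  | succ s ih =>
    rw [ih]
    by_cases hs : ∃ i ∈ L, i ∈ I ∧ L.idxOf i = s
    · obtain ⟨i, hiL, hiI, his⟩ := hs
      rw [← Finset.sum_filter_add_sum_filter_not (S.filter _) (fun a => a i ≤ eS L a i)]
      have hz : ∑ a ∈ (S.filter (fun a => ∀ i ∈ L, i ∈ I → L.idxOf i < s → a i ≤ eS L a i)).filter
          (fun a => ¬ a i ≤ eS L a i), Alt b (mono n (ρ + bet n lam a)) = 0 := by
        have hmem : ∀ a, a ∈ (S.filter (fun a => ∀ i ∈ L, i ∈ I → L.idxOf i < s → a i ≤ eS L a i)).filter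
          (fun a => ¬ a i ≤ eS L a i) → flip n lam i a ∈ (S.filter (fun a => ∀ i ∈ L, i ∈ I → L.idxOf i < s → a i ≤ eS L a i)).filter
          (fun a => ¬ a i ≤ eS L a i) := by
          intro a ha
          rw [Finset.mem_filter, Finset.mem_filter] at ha ⊢
          obtain ⟨⟨h1, h2⟩, h3⟩ := ha
          obtain ⟨h4, h5⟩ := flip_cond hL ((hS a).mp h1) hiL h3
          refine ⟨⟨(hS _).mpr h4, ?_⟩, h5⟩
          intro j hjL hjI hjs
          rw [flip_eS (hL i hiL).1 j (hL j hjL).1 (by omega), flip_ne (by rintro rfl; omega)]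
          exact h2 j hjL hjI hjs
        have hsign : ∀ a, a ∈ (S.filter (fun a => ∀ i ∈ L, i ∈ I → L.idxOf i < s → a i ≤ eS L a i)).filter
          (fun a => ¬ a i ≤ eS L a i) → Alt b (mono n (ρ + bet n lam (flip n lam i a))) =
            - Alt b (mono n (ρ + bet n lam a)) := by
          intro a ha
          have hm := hmem a ha
          rw [Finset.mem_filter, Finset.mem_filter] at ha hm
          have hi := hL i hiL
          have hsp := cond_split ((hS a).mp ha.1.1) hiL hi.1
          obtain ⟨p, rfl⟩ : ∃ p, i = p + 1 := ⟨i - 1, by omega⟩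
          have hp : p + 1 < n := by omega
          apply flip_sign hρ hl hp ((hIb p hp).mp hiI) (hn a ha.1.1) (hn _ hm.1.1)
          simp only [Nat.add_sub_cancel] at hsp
          omega
        refine Finset.sum_involution (fun a _ => flip n lam i a) ?_ ?_ (fun a ha => hmem a ha) ?_
        · intro a ha
          rw [hsign a ha]; ring
        · intro a ha hne heq
          apply hne
          have := hsign a ha
          rw [heq] at this
          exact self_eq_neg.mp this
        · intro a ha
          rw [Finset.mem_filter, Finset.mem_filter] at ha
          exact flip_flip hL ((hS a).mp ha.1.1) hiL
      rw [hz, add_zero, Finset.filter_filter]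
      apply Finset.sum_congr _ (fun _ _ => rfl)
      apply Finset.filter_congr
      intro a _
      constructor
      · rintro ⟨h1, h2⟩ j hjL hjI hjs
        by_cases hj : L.idxOf j < s
        · exact h1 j hjL hjI hj
        · have : j = i := (List.idxOf_inj hjL).mp (by omega)
          rw [this]; exact h2
      · intro h
        exact ⟨fun j h1 h2 h3 => h j h1 h2 (by omega), h i hiL hiI (by omega)⟩
    · apply Finset.sum_congr _ (fun _ _ => rfl)
      apply Finset.filter_congr
      intro a _
      constructor
      · intro h j hjL hjI hjs
        apply h j hjL hjI
        have : L.idxOf j ≠ s := fun e => hs ⟨j, hjL, hjI, e⟩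
        omega
      · intro h j h1 h2 h3
        exact h j h1 h2 (by omega)

end main

section fin
variable {n k : ℕ} {d : Fin (k + 2) → ℕ} {b : Fin n → Fin (k + 1)}

/-- from compositions to tuples of partitions -/
def gam (n k : ℕ) (d : Fin (k + 2) → ℕ) (β : Fin n → ℕ) : Fin (k + 1) → ℕ → ℕ := fun t m =>
  if 1 ≤ m ∧ m ≤ d t.succ - d t.castSucc then ent n β (d t.castSucc + (m - 1)) else 0

theorem gam_eq (hb : IsLab d b) (β : Fin n → ℕ) (j : Fin n) :
    β j = gam n k d β (b j) (j.1 - d (b j).castSucc + 1) := by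
  obtain ⟨h1, h2⟩ := hb j
  unfold gam
  rw [if_pos (by omega)]
  have : d (b j).castSucc + (j.1 - d (b j).castSucc + 1 - 1) = j.1 := by omega
  rw [this]
  unfold ent
  rw [dif_pos j.2]

theorem gam_par (hd : BlockData n k d) (hb : IsLab d b) (β : Fin n → ℕ)
    (hβ : ∀ p (hp : p + 1 < n), b ⟨p, by omega⟩ = b ⟨p + 1, hp⟩ → β ⟨p + 1, hp⟩ ≤ β ⟨p, by omega⟩) :
    ParD k d (gam n k d β) := by
  intro t
  have hdn : d t.succ ≤ n := by
    rw [← hd.2.1]; exact hd.2.2.monotone (Fin.le_last _)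
  refine ⟨by simp [gam], ?_, ?_⟩
  · intro x y hx hxy
    unfold gam
    by_cases hy : y ≤ d t.succ - d t.castSucc
    · rw [if_pos ⟨by omega, hy⟩, if_pos ⟨hx, by omega⟩]
      rcases hxy.eq_or_lt with rfl | hlt
      · exact le_rfl
      unfold ent
      rw [dif_pos (by omega), dif_pos (by omega)]
      refine adj_chain (fun x y => β y ≤ β x) (fun x y z h1 h2 => h2.trans h1) ⟨d t.castSucc + (x - 1), by omega⟩
        (d t.castSucc + (y - 1)) (by omega) (by simp only; omega) ?_
      intro p hp h1 h2
      simp only at h1 h2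
      apply hβ p hp
      have e1 : b ⟨p, by omega⟩ = t := (lab_iff hd hb _ _).mpr (by simp only; omega)
      have e2 : b ⟨p + 1, hp⟩ = t := (lab_iff hd hb _ _).mpr (by simp only; omega)
      rw [e1, e2]
    · rw [if_neg (by omega)]; omega
  · intro m hm
    unfold gam
    rw [if_neg (by omega)]

theorem bet_inj {lam : Fin n → ℕ} {L : List ℕ} (hL : ∀ j ∈ L, 1 ≤ j ∧ j ≤ n - 1) {a a' : ℕ → ℕ}
    (h : CondR n lam L a) (h' : CondR n lam L a')
    (hn : ∀ j : Fin n, a (j.1 + 1) ≤ lam j + a j.1)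
    (hn' : ∀ j : Fin n, a' (j.1 + 1) ≤ lam j + a' j.1)
    (he : bet n lam a = bet n lam a') : a = a' := by
  funext m
  induction m with
  | zero =>
    have : 0 ∉ L := fun h0 => by have := hL 0 h0; omega
    rw [h.1 0 this, h'.1 0 this]
  | succ m ih =>
    by_cases hm : m < n
    · have h1 := congrFun he ⟨m, hm⟩
      have h2 := hn ⟨m, hm⟩
      have h3 := hn' ⟨m, hm⟩
      simp only [bet] at h1 h2 h3
      omega
    · have : m + 1 ∉ L := fun h0 => by have := hL _ h0; omega
      rw [h.1 _ this, h'.1 _ this]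

theorem forward (hd : BlockData n k d) (hb : IsLab d b) (I : Set ℕ)
    (hIb : ∀ p (hp : p + 1 < n), p + 1 ∈ I ↔ b ⟨p, by omega⟩ = b ⟨p + 1, hp⟩)
    (v w : Equiv.Perm (Fin n)) (hv : ∀ i, b (v i) = b i)
    (hw : ∀ i j, i < j → b i = b j → w⁻¹ j < w⁻¹ i)
    (hc : IsStdCox n (v * w)) (lam : Fin n → ℕ) (hl : IsPartition n lam) :
    ∃ T : Finset (Fin (k + 1) → ℕ → ℕ), (∀ γ ∈ T, ParD k d γ) ∧
      keyPoly n (pact n w lam) = ∑ γ ∈ T, dSchur n k d γ := by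
  obtain ⟨L, hnd, hL, hprod⟩ := hc
  have hm := lab_mono hd hb
  have hρ := rho_isRho hb
  obtain ⟨S, hS, hnn, hsum⟩ := expansion lam hl L hnd hL
  have h1 := key_delta b hm hρ v w hv hw lam hl
  rw [← hprod, key_nodup lam hl L hnd hL, hsum, Finset.mul_sum, map_sum] at h1
  simp only [mono_mul] at h1
  rw [cancel hρ hl hnd hL I hIb S hS hnn L.length] at h1
  set S' := S.filter (fun a => ∀ i ∈ L, i ∈ I → L.idxOf i < L.length → a i ≤ eS L a i) with hS'
  refine ⟨S'.image fun a => gam n k d (bet n lam a), ?_, ?_⟩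
  · intro γ hγ
    rw [Finset.mem_image] at hγ
    obtain ⟨a, ha, rfl⟩ := hγ
    rw [hS', Finset.mem_filter] at ha
    apply gam_par hd hb
    intro p hp hbp
    have hp0 : p < n := by omega
    have hlp : lam ⟨p + 1, hp⟩ ≤ lam ⟨p, hp0⟩ := hl _ _ (by simp [Fin.le_def])
    have hg : gp n lam (p + 1) = lam ⟨p, by omega⟩ - lam ⟨p + 1, hp⟩ := by
      unfold gp ent
      rw [dif_pos hp, dif_pos (by omega)]
      rfl
    have a1 := hnn a ha.1 ⟨p, hp0⟩
    have a2 := hnn a ha.1 ⟨p + 1, hp⟩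
    simp only [bet] at a1 a2 ⊢
    have hC := (hS a).mp ha.1
    by_cases hpL : p + 1 ∈ L
    · have h2 := ha.2 (p + 1) hpL ((hIb p hp).mpr hbp) (List.idxOf_lt_length_of_mem hpL)
      have h3 := cond_split hC hpL (by omega)
      simp only [Nat.add_sub_cancel] at h3
      omega
    · have := hC.1 _ hpL
      omega
  · rw [Finset.sum_image]
    · apply mul_right_cancel₀ (delta_ne hd hb)
      rw [h1, Finset.sum_mul]
      apply Finset.sum_congr rfl
      intro a _
      rw [jacobi_trudi hd hb _ _ (gam_eq hb _), mul_comm]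
    · intro a ha a' ha' he
      rw [hS', Finset.mem_coe, Finset.mem_filter] at ha ha'
      apply bet_inj hL ((hS a).mp ha.1) ((hS a').mp ha'.1) (hnn a ha.1) (hnn a' ha'.1)
      funext j
      rw [gam_eq hb (bet n lam a), gam_eq hb (bet n lam a')]
      exact congrFun (congrFun he _) _

end fin
end LSS

open scoped Classical
set_option linter.unusedSimpArgs false
set_option linter.unusedSectionVars false
namespace LSS
open MvPolynomial

/-! Weighted homogeneity is preserved by the Demazure operators. -/

theorem weight_expOf {n : ℕ} (ψ β : Fin n → ℕ) :
    Finsupp.weight ψ (expOf n β) = ∑ j, β j * ψ j := by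
  rw [Finsupp.weight_apply, Finsupp.sum_fintype _ _ (by simp)]
  simp [expOf]

theorem mono_wh {n : ℕ} (ψ β : Fin n → ℕ) (D : ℕ) (h : ∑ j, β j * ψ j = D) :
    IsWeightedHomogeneous ψ (mono n β) D :=
  isWeightedHomogeneous_monomial _ _ _ (by rw [weight_expOf, h])

theorem wh_sum {n : ℕ} {ι : Type*} (ψ : Fin n → ℕ) (D : ℕ) (s : Finset ι)
    (F : ι → MvPolynomial (Fin n) ℤ) (h : ∀ i ∈ s, IsWeightedHomogeneous ψ (F i) D) :
    IsWeightedHomogeneous ψ (∑ i ∈ s, F i) D :=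
  (weightedHomogeneousSubmodule ℤ ψ D).sum_mem h

theorem sum_two {n p : ℕ} (hp : p + 1 < n) (f : Fin n → ℕ) :
    ∑ j, f j = f ⟨p, by omega⟩ + f ⟨p + 1, hp⟩ +
      ∑ j ∈ Finset.univ.filter (fun j : Fin n => j.1 ≠ p ∧ j.1 ≠ p + 1), f j := by
  rw [← Finset.sum_filter_add_sum_filter_not Finset.univ
    (fun j : Fin n => j.1 ≠ p ∧ j.1 ≠ p + 1) f, add_comm]
  congr 1
  have : (Finset.univ.filter fun j : Fin n => ¬ (j.1 ≠ p ∧ j.1 ≠ p + 1)) =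
      {⟨p, by omega⟩, ⟨p + 1, hp⟩} := by
    ext j
    simp only [Finset.mem_filter, Finset.mem_univ, true_and, Finset.mem_insert,
      Finset.mem_singleton, Fin.ext_iff]
    omega
  rw [this, Finset.sum_pair (by simp)]

theorem dem_mono_wh1 {n p : ℕ} (hp : p + 1 < n) (ψ β : Fin n → ℕ)
    (hψ : ψ ⟨p, by omega⟩ = ψ ⟨p + 1, hp⟩) (hβ : β ⟨p + 1, hp⟩ ≤ β ⟨p, by omega⟩) :
    IsWeightedHomogeneous ψ (dem n (p + 1) (mono n β)) (∑ j, β j * ψ j) := by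
  rw [dem_mono hp β hβ]
  refine wh_sum _ _ _ _ fun t ht => mono_wh _ _ _ ?_
  rw [Finset.mem_range] at ht
  rw [sum_two hp, sum_two hp (fun j => β j * ψ j)]
  congr 1
  · simp only [if_true, hψ]
    rw [if_neg (by omega), ← add_mul, ← add_mul]
    congr 1
    omega
  · refine Finset.sum_congr rfl fun j hj => ?_
    simp only [Finset.mem_filter, Finset.mem_univ, true_and] at hj
    rw [if_neg hj.1, if_neg hj.2]

theorem dem_mono_wh {n p : ℕ} (hp : p + 1 < n) (ψ β : Fin n → ℕ)
    (hψ : ψ ⟨p, by omega⟩ = ψ ⟨p + 1, hp⟩) :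
    IsWeightedHomogeneous ψ (dem n (p + 1) (mono n β)) (∑ j, β j * ψ j) := by
  rcases le_total (β ⟨p + 1, hp⟩) (β ⟨p, by omega⟩) with h | h
  · exact dem_mono_wh1 hp ψ β hψ h
  · have hw : ∑ j, (β ∘ asw hp) j * ψ j = ∑ j, β j * ψ j := by
      rw [← Equiv.sum_comp (asw hp) (fun j => β j * ψ j)]
      refine Finset.sum_congr rfl fun j _ => ?_
      simp only [Function.comp]
      congr 1
      by_cases h1 : j = ⟨p, by omega⟩
      · subst h1; rw [asw_left]; exact hψ
      by_cases h2 : j = ⟨p + 1, hp⟩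
      · subst h2; rw [asw_right]; exact hψ.symm
      rw [asw_of_ne hp j (fun h => h1 (Fin.ext h)) (fun h => h2 (Fin.ext h))]
    have hr : rename (⇑(asw hp)) (mono n β) = mono n (β ∘ asw hp) := by
      rw [rename_mono, asw_inv]
    have hr2 : rename (⇑(asw hp)) (mono n (β ∘ asw hp)) = mono n β := by
      rw [rename_mono, asw_inv]; congr 1; funext j; simp [asw_asw]
    have h1 := dem_mono_wh1 hp ψ (β ∘ asw hp) hψ (by
      simp only [Function.comp, asw_left, asw_right]; exact h)
    rw [hw] at h1
    have hs : dem n (p + 1) (mono n β + mono n (β ∘ asw hp)) =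
        mono n β + mono n (β ∘ asw hp) := by
      apply dem_of_symm hp
      change rename (⇑(asw hp)) _ = _
      rw [map_add, hr, hr2, add_comm]
    rw [dem_add hp] at hs
    rw [eq_sub_of_add_eq hs]
    exact (weightedHomogeneousSubmodule ℤ ψ _).sub_mem
      ((weightedHomogeneousSubmodule ℤ ψ _).add_mem (mono_wh _ _ _ rfl) (mono_wh _ _ _ hw)) h1

theorem dem_wh {n p : ℕ} (hp : p + 1 < n) (ψ : Fin n → ℕ)
    (hψ : ψ ⟨p, by omega⟩ = ψ ⟨p + 1, hp⟩) (f : MvPolynomial (Fin n) ℤ) (D : ℕ)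
    (hf : IsWeightedHomogeneous ψ f D) : IsWeightedHomogeneous ψ (dem n (p + 1) f) D := by
  have hm : ∀ v : Fin n →₀ ℕ, monomial v (coeff v f) = coeff v f • mono n (⇑v) := by
    intro v
    have : expOf n (⇑v) = v := by ext; simp [expOf]
    rw [mono, this, smul_monomial, smul_eq_mul, mul_one]
  rw [f.as_sum, dem_sum hp]
  refine wh_sum _ _ _ _ fun v hv => ?_
  rw [hm, dem_smul hp]
  refine (weightedHomogeneousSubmodule ℤ ψ _).smul_mem _ ?_
  have := dem_mono_wh hp ψ (⇑v) hψ
  have h2 := hf (mem_support_iff.1 hv)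
  rw [← weight_expOf] at this
  have h3 : expOf n (⇑v) = v := by ext; simp [expOf]
  rw [h3, h2] at this
  exact this

theorem demWord_wh {n : ℕ} (L : List ℕ) (hL : ∀ i ∈ L, 1 ≤ i ∧ i ≤ n - 1) (ψ : Fin n → ℕ)
    (hψ : ∀ p (hp : p + 1 < n), p + 1 ∈ L → ψ ⟨p, by omega⟩ = ψ ⟨p + 1, hp⟩)
    (f : MvPolynomial (Fin n) ℤ) (D : ℕ)
    (hf : IsWeightedHomogeneous ψ f D) : IsWeightedHomogeneous ψ (demWord n L f) D := by
  induction L with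
  | nil => exact hf
  | cons a L ih =>
    have ha := hL a (by simp)
    obtain ⟨p, rfl⟩ : ∃ p, a = p + 1 := ⟨a - 1, by omega⟩
    have hp : p + 1 < n := by omega
    exact dem_wh hp ψ (hψ p hp (by simp)) _ _
      (ih (fun i hi => hL i (by simp [hi])) (fun q hq h => hψ q hq (by simp [h])))

/-- partial sums -/
def psum {n : ℕ} (β : Fin n → ℕ) (q : ℕ) : ℕ := ∑ j, β j * (if j.1 < q then 1 else 0)

theorem psum_succ {n : ℕ} (β : Fin n → ℕ) (j : Fin n) :
    psum β (j.1 + 1) = psum β j.1 + β j := by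
  have : ∀ i : Fin n, β i * (if i.1 < j.1 + 1 then 1 else 0) =
      β i * (if i.1 < j.1 then 1 else 0) + (if i = j then β i else 0) := by
    intro i
    rcases lt_trichotomy i.1 j.1 with h | h | h
    · rw [if_pos (by omega), if_pos h, if_neg (by rintro rfl; omega)]; simp
    · rw [if_pos (by omega), if_neg (by omega), if_pos (Fin.ext h)]; simp
    · rw [if_neg (by omega), if_neg (by omega), if_neg (by rintro rfl; omega)]; simp
  simp only [psum, this, Finset.sum_add_distrib]
  simp

theorem psum_inj {n : ℕ} (β β' : Fin n → ℕ) (h : ∀ q ≤ n, psum β q = psum β' q) : β = β' := by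
  funext j
  have h1 := psum_succ β j
  have h2 := psum_succ β' j
  have h3 := h (j.1 + 1) (by omega)
  have h4 := h j.1 (by omega)
  omega

theorem psum_le {n : ℕ} (β : Fin n → ℕ) (q : ℕ) : psum β q ≤ psum β n := by
  refine Finset.sum_le_sum fun j _ => Nat.mul_le_mul_left _ ?_
  split_ifs <;> simp_all

theorem supp_card {n : ℕ} (L : List ℕ) (hL : ∀ i ∈ L, 1 ≤ i ∧ i ≤ n - 1) (lam : Fin n → ℕ) :
    (demWord n L (mono n lam)).support.card ≤ (psum lam n + 1) ^ L.toFinset.card := by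
  have key : ∀ q, q ∉ L → ∀ v ∈ (demWord n L (mono n lam)).support, psum (⇑v) q = psum lam q := by
    intro q hq v hv
    have := demWord_wh L hL (fun j => if j.1 < q then 1 else 0) (by
      intro p hp hpL
      have : q ≠ p + 1 := by rintro rfl; exact hq hpL
      by_cases h : p < q
      · simp only; rw [if_pos h, if_pos (by omega)]
      · simp only; rw [if_neg h, if_neg (by omega)]) (mono n lam) (psum lam q) (mono_wh _ _ _ rfl)
      (mem_support_iff.1 hv)
    rw [← this]
    have h3 : expOf n (⇑v) = v := by ext; simp [expOf]
    conv_rhs => rw [← h3]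
    rw [weight_expOf]; rfl
  have hn : n ∉ L := fun h => by have := hL n h; omega
  have hc : (Finset.univ : Finset ({q // q ∈ L.toFinset} → Fin (psum lam n + 1))).card =
      (psum lam n + 1) ^ L.toFinset.card := by
    rw [Finset.card_univ, Fintype.card_fun, Fintype.card_fin, Fintype.card_coe]
  rw [← hc]
  refine Finset.card_le_card_of_injOn
    (fun v q => Fin.ofNat (psum lam n + 1) (psum (⇑v) q.1)) (by simp) ?_
  intro v hv v' hv' h
  apply DFunLike.coe_injective
  apply psum_inj
  intro q _
  by_cases hq : q ∈ L
  · have := congrFun h ⟨q, by simpa using hq⟩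
    simp only [Fin.ofNat, Fin.mk.injEq] at this
    have h1 := key n hn v hv
    have h2 := key n hn v' hv'
    have h3 := psum_le (⇑v) q
    have h4 := psum_le (⇑v') q
    rwa [Nat.mod_eq_of_lt (by omega), Nat.mod_eq_of_lt (by omega)] at this
  · rw [key q hq v hv, key q hq v' hv']

end LSS

open scoped Classical
set_option linter.unusedSimpArgs false
set_option linter.unusedSectionVars false
namespace LSS
open MvPolynomial

theorem card_le_support {n : ℕ} {ι : Type*} (S : Finset ι) (ε : ι → ℤ) (e : ι → (Fin n → ℕ))
    (hε : ∀ s ∈ S, ε s ≠ 0) (he : Set.InjOn e S) :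
    S.card ≤ (∑ s ∈ S, ε s • mono n (e s)).support.card := by
  refine Finset.card_le_card_of_injOn (fun s => expOf n (e s)) ?_ ?_
  · intro s hs
    have hs' : s ∈ S := hs
    simp only [Finset.mem_coe, mem_support_iff, coeff_sum]
    rw [Finset.sum_eq_single s]
    · simp only [mono, coeff_smul, coeff_monomial, if_true, smul_eq_mul, mul_one]
      exact hε s hs
    · intro t ht hts
      simp only [mono, coeff_smul, coeff_monomial]
      rw [if_neg, smul_zero]
      intro h
      exact hts (he ht hs (expOf_inj.1 h))
    · intro h; exact absurd hs h
  · intro s hs t ht h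
    exact he hs ht (expOf_inj.1 h)

theorem block_rigid {n : ℕ} {τ : Type*} [LinearOrder τ] (b : Fin n → τ) (hb : Monotone b)
    (μ μ' : Fin n → ℕ) (h : ∀ i j, i < j → b i = b j → μ j < μ i)
    (h' : ∀ i j, i < j → b i = b j → μ' j < μ' i) (π : Equiv.Perm (Fin n))
    (hπ : ∀ i, b (π i) = b i) (he : μ = μ' ∘ π) : π = 1 := by
  apply perm_eq_one
  intro i j hij
  rcases (hb hij.le).lt_or_eq with hlt | heq
  · rw [← hπ i, ← hπ j] at hlt
    by_contra hc
    exact absurd (hb (not_lt.1 hc)) (not_le.2 hlt)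
  · have h1 := h i j hij heq
    rw [he] at h1
    simp only [Function.comp] at h1
    rcases lt_trichotomy (π i) (π j) with h2 | h2 | h2
    · exact h2
    · rw [h2] at h1; omega
    · have := h' _ _ h2 (by rw [hπ, hπ, heq]); omega

theorem eval_mono_le {n : ℕ} (x : Fin n → ℝ) (hx : ∀ i, 0 ≤ x i ∧ x i ≤ 1) (β : Fin n → ℕ) :
    |aeval x (mono n β)| ≤ 1 := by
  rw [mono_prod, map_prod, Finset.abs_prod]
  refine Finset.prod_le_one (fun _ _ => abs_nonneg _) fun i _ => ?_
  rw [map_pow, aeval_X, abs_of_nonneg (pow_nonneg (hx i).1 _)]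
  exact pow_le_one₀ (hx i).1 (hx i).2

theorem Alt_support_card {n : ℕ} {τ : Type*} [LinearOrder τ] (b : Fin n → τ) (ρ : Fin n → ℕ)
    (f : MvPolynomial (Fin n) ℤ) :
    (Alt b (mono n ρ * f)).support.card ≤ n.factorial * f.support.card := by
  rw [Alt_apply]
  refine le_trans (Finset.card_le_card (support_sum)) ?_
  refine le_trans Finset.card_biUnion_le ?_
  refine le_trans (Finset.sum_le_card_nsmul _ _ f.support.card ?_) ?_
  · intro σ _
    refine le_trans (Finset.card_le_card support_smul) ?_
    rw [support_rename_of_injective σ.injective]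
    refine le_trans Finset.card_image_le ?_
    refine le_trans (Finset.card_le_card (support_mul _ _)) ?_
    refine le_trans Finset.card_add_le ?_
    have : (mono n ρ).support.card ≤ 1 := by
      refine le_trans (Finset.card_le_card support_monomial_subset) ?_
      simp
    nlinarith
  · rw [smul_eq_mul]
    refine Nat.mul_le_mul_right _ ?_
    refine le_trans (Finset.card_le_univ _) ?_
    rw [Fintype.card_perm, Fintype.card_fin]

section
variable {n k : ℕ} {d : Fin (k + 2) → ℕ} {b : Fin n → Fin (k + 1)}

theorem ParD_inj (hd : BlockData n k d) (hb : IsLab d b) (γ γ' : Fin (k + 1) → ℕ → ℕ)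
    (h : ParD k d γ) (h' : ParD k d γ')
    (he : ∀ j : Fin n, γ (b j) (j.1 - d (b j).castSucc + 1) =
      γ' (b j) (j.1 - d (b j).castSucc + 1)) : γ = γ' := by
  funext t m
  rcases Nat.eq_zero_or_pos m with rfl | hm
  · rw [(h t).1, (h' t).1]
  by_cases hm2 : d t.succ - d t.castSucc < m
  · rw [(h t).2.2 m hm2, (h' t).2.2 m hm2]
  have hlt : d t.castSucc < d t.succ := hd.2.2 Fin.castSucc_lt_succ
  have hle : d t.succ ≤ n := by
    rw [← hd.2.1]; exact hd.2.2.monotone (Fin.le_last _)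
  have hj : d t.castSucc + (m - 1) < n := by omega
  have hbj : b ⟨d t.castSucc + (m - 1), hj⟩ = t := by
    rw [lab_iff hd hb]; constructor
    · simp
    · simp only; omega
  have := he ⟨d t.castSucc + (m - 1), hj⟩
  rw [hbj] at this
  have e : d t.castSucc + (m - 1) - d t.castSucc + 1 = m := by omega
  simpa only [e] using this

theorem G_bound (hd : BlockData n k d) (hb : IsLab d b) (v w : Equiv.Perm (Fin n))
    (hv : ∀ i, b (v i) = b i) (hw : ∀ i j, i < j → b i = b j → w⁻¹ j < w⁻¹ i)
    (lam : Fin n → ℕ) (hl : IsPartition n lam) (T : Finset (Fin (k + 1) → ℕ → ℕ))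
    (hT : ∀ γ ∈ T, ParD k d γ) (hk : keyPoly n (pact n w lam) = ∑ γ ∈ T, dSchur n k d γ)
    (x : Fin n → ℝ) (hx : ∀ i, 0 ≤ x i ∧ x i ≤ 1) :
    |aeval x (keyPoly n (pact n w lam) * ∏ q ∈ prs b, (X q.1 - X q.2))| ≤
      (n.factorial * (keyPoly n (pact n (v * w) lam)).support.card : ℕ) := by
  set βf : (Fin (k + 1) → ℕ → ℕ) → Fin n → ℕ :=
    fun γ j => γ (b j) (j.1 - d (b j).castSucc + 1) with hβf
  have hbm := lab_mono hd hb
  rw [← delta_prod hd hb]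
  have hG : keyPoly n (pact n w lam) * Alt b (mono n (rho d b)) =
      ∑ s ∈ T ×ˢ blk b, ((Equiv.Perm.sign s.2 : ℤˣ) : ℤ) •
        mono n ((rho d b + βf s.1) ∘ ⇑(s.2⁻¹)) := by
    rw [hk, Finset.sum_mul, Finset.sum_product]
    refine Finset.sum_congr rfl fun γ hγ => ?_
    rw [mul_comm, ← jacobi_trudi hd hb (βf γ) γ (fun _ => rfl), Alt_apply]
    refine Finset.sum_congr rfl fun σ _ => ?_
    rw [rename_mono]
  have hcard := card_le_support (T ×ˢ blk b) (fun s => ((Equiv.Perm.sign s.2 : ℤˣ) : ℤ))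
    (fun s => (rho d b + βf s.1) ∘ ⇑(s.2⁻¹)) (fun s _ => Units.ne_zero _) (by
      have hstr : ∀ γ ∈ T, ∀ i j : Fin n, i < j → b i = b j →
          (rho d b + βf γ) j < (rho d b + βf γ) i := by
        intro γ hγ i j hij hbij
        have h1 := (hT γ hγ (b j)).2.1 (i.1 - d (b j).castSucc + 1) (j.1 - d (b j).castSucc + 1)
          (by omega) (by have : i.1 < j.1 := hij; omega)
        have h2 := hb j
        have h3 : i.1 < j.1 := hij
        simp only [Pi.add_apply, hβf, rho, hbij]
        omega
      rintro ⟨γ, σ⟩ hs ⟨γ', σ'⟩ hs' he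
      simp only [Finset.coe_product, Set.mem_prod, Finset.mem_coe, mem_blk] at hs hs'
      simp only at he
      have he2 : (rho d b + βf γ) = (rho d b + βf γ') ∘ ⇑(σ'⁻¹ * σ) := by
        funext i
        have := congrFun he (σ i)
        simpa using this
      have h1 := block_rigid b hbm _ _ (hstr γ hs.1) (hstr γ' hs'.1) (σ'⁻¹ * σ) (by
        intro i
        rw [Equiv.Perm.mul_apply, block_inv b hs'.2, hs.2]) he2
      have h2 : σ = σ' := by
        rw [inv_mul_eq_one] at h1; exact h1.symm
      rw [h1] at he2
      have h3 : γ = γ' := by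
        apply ParD_inj hd hb _ _ (hT _ hs.1) (hT _ hs'.1)
        intro j
        have := congrFun he2 j
        simpa [hβf] using this
      rw [h2, h3])
  rw [← hG, key_delta b hbm (rho_isRho hb) v w hv hw lam hl] at hcard
  have h2 := hcard.trans (Alt_support_card b _ _)
  refine le_trans ?_ (Nat.cast_le.2 h2)
  rw [hG, map_sum]
  refine le_trans (Finset.abs_sum_le_sum_abs _ _) ?_
  refine le_trans (Finset.sum_le_card_nsmul _ _ 1 ?_) (by simp)
  intro s _
  rw [map_zsmul, zsmul_eq_mul, abs_mul]
  have : |((((Equiv.Perm.sign s.2 : ℤˣ) : ℤ)) : ℝ)| = 1 := by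
    rcases Int.units_eq_one_or (Equiv.Perm.sign s.2) with h | h <;> rw [h] <;> simp
  rw [this, one_mul]
  exact eval_mono_le x hx _

end
end LSS

open scoped Classical
set_option linter.unusedSimpArgs false
set_option linter.unusedSectionVars false
namespace LSS
open MvPolynomial

/-- evaluation points -/
noncomputable def xx {n : ℕ} (m : ℕ) (σ : Equiv.Perm (Fin n)) (j : Fin n) : ℝ :=
  Real.exp (-(((σ j).1 : ℝ) / m))

theorem xx_mem {n : ℕ} (m : ℕ) (σ : Equiv.Perm (Fin n)) (j : Fin n) :
    0 ≤ xx m σ j ∧ xx m σ j ≤ 1 := by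
  refine ⟨(Real.exp_pos _).le, ?_⟩
  rw [xx, Real.exp_le_one_iff, neg_nonpos]
  positivity

theorem exp_low (t : ℝ) (h0 : 0 ≤ t) (h1 : t ≤ 1) : t / 2 ≤ 1 - Real.exp (-t) := by
  have h := Real.add_one_le_exp t
  have h2 : Real.exp (-t) ≤ 1 - t / 2 := by
    rw [Real.exp_neg, inv_le_comm₀ (Real.exp_pos _) (by linarith)]
    refine le_trans ?_ h
    rw [inv_le_iff_one_le_mul₀ (by linarith)]
    nlinarith
  linarith

theorem exp_sub_low (N m a c : ℕ) (hm : 1 ≤ m) (hac : a < c) (hc : c ≤ N) :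
    Real.exp (-(N : ℝ)) / 2 / m ≤ Real.exp (-((a : ℝ) / m)) - Real.exp (-((c : ℝ) / m)) := by
  have hm' : (1 : ℝ) ≤ m := by exact_mod_cast hm
  have ha : Real.exp (-(N : ℝ)) ≤ Real.exp (-((a : ℝ) / m)) := by
    rw [Real.exp_le_exp, neg_le_neg_iff]
    rw [div_le_iff₀ (by linarith)]
    have : (a : ℝ) ≤ N := by exact_mod_cast (by omega : a ≤ N)
    nlinarith [(Nat.cast_nonneg a : (0 : ℝ) ≤ a)]
  have hc2 : Real.exp (-((c : ℝ) / m)) ≤ Real.exp (-((a : ℝ) / m)) * Real.exp (-(1 / (m : ℝ))) := by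
    rw [← Real.exp_add, Real.exp_le_exp]
    have : (a : ℝ) + 1 ≤ c := by exact_mod_cast hac
    rw [← neg_add, neg_le_neg_iff, ← add_div]
    gcongr
  have hl := exp_low (1 / (m : ℝ)) (by positivity) (by rw [div_le_one (by linarith)]; exact hm')
  have hp : (0 : ℝ) ≤ 1 / (m : ℝ) / 2 := by positivity
  calc Real.exp (-(N : ℝ)) / 2 / m = Real.exp (-(N : ℝ)) * (1 / (m : ℝ) / 2) := by ring
    _ ≤ Real.exp (-((a : ℝ) / m)) * (1 - Real.exp (-(1 / (m : ℝ)))) := by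
        apply mul_le_mul ha hl hp (Real.exp_pos _).le
    _ ≤ _ := by linarith

theorem xx_low {n : ℕ} (m : ℕ) (hm : 1 ≤ m) (σ : Equiv.Perm (Fin n)) (i j : Fin n) (h : i ≠ j) :
    Real.exp (-(n : ℝ)) / 2 / m ≤ |xx m σ i - xx m σ j| := by
  have h' : (σ i).1 ≠ (σ j).1 := fun e => h (σ.injective (Fin.ext e))
  rcases lt_or_gt_of_ne h' with h1 | h1
  · exact (exp_sub_low n m _ _ hm h1 (σ j).2.le).trans (le_abs_self _)
  · rw [abs_sub_comm]
    exact (exp_sub_low n m _ _ hm h1 (σ i).2.le).trans (le_abs_self _)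

theorem xx_up {n : ℕ} (m : ℕ) (hm : 1 ≤ m) (i j : Fin n) (h : i < j) :
    |xx m (1 : Equiv.Perm (Fin n)) i - xx m 1 j| ≤ n / m := by
  have hm' : (1 : ℝ) ≤ m := by exact_mod_cast hm
  simp only [xx, Equiv.Perm.one_apply]
  have hij : (i.1 : ℝ) ≤ j.1 := by exact_mod_cast h.le
  have hj : (j.1 : ℝ) ≤ n := by exact_mod_cast j.2.le
  have h1 : Real.exp (-((j.1 : ℝ) / m)) ≤ Real.exp (-((i.1 : ℝ) / m)) := by
    rw [Real.exp_le_exp, neg_le_neg_iff]; gcongr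
  rw [abs_of_nonneg (by linarith)]
  have h2 := Real.add_one_le_exp (-((j.1 : ℝ) / m))
  have h3 : Real.exp (-((i.1 : ℝ) / m)) ≤ 1 := by
    rw [Real.exp_le_one_iff, neg_nonpos]; positivity
  have h4 : (j.1 : ℝ) / m ≤ n / m := by gcongr
  linarith

theorem xx_pow_low {n : ℕ} (m : ℕ) (hm : 1 ≤ m) (i j : Fin n) (h : i < j) :
    Real.exp (-(2 * n : ℝ)) / 2 ≤
      |xx m (1 : Equiv.Perm (Fin n)) i ^ (m + 1) - xx m 1 j ^ (m + 1)| := by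
  have hm' : (1 : ℝ) ≤ m := by exact_mod_cast hm
  have hm0 : (m : ℝ) ≠ 0 := by linarith
  have e : ∀ a : Fin n, xx m (1 : Equiv.Perm (Fin n)) a ^ (m + 1) =
      Real.exp (-((a.1 : ℝ) * (1 + 1 / m))) := by
    intro a
    rw [xx, ← Real.exp_nat_mul]
    congr 1
    simp only [Equiv.Perm.one_apply]
    push_cast
    field_simp
  rw [e, e]
  refine le_trans ?_ (le_abs_self _)
  set t : ℝ := 1 + 1 / m with ht
  have ht1 : 1 ≤ t := by rw [ht]; have : (0 : ℝ) ≤ 1 / m := by positivity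
                         linarith
  have ht2 : t ≤ 2 := by
    have : (1 : ℝ) / m ≤ 1 := by rw [div_le_one (by linarith)]; exact hm'
    linarith
  have hi : (i.1 : ℝ) ≤ n := by exact_mod_cast i.2.le
  have hij : (i.1 : ℝ) + 1 ≤ j.1 := by exact_mod_cast h
  have h0 : (0 : ℝ) ≤ i.1 := by positivity
  have h1 : Real.exp (-(2 * n : ℝ)) ≤ Real.exp (-((i.1 : ℝ) * t)) := by
    rw [Real.exp_le_exp]; nlinarith
  have h2 : Real.exp (-((j.1 : ℝ) * t)) ≤ Real.exp (-((i.1 : ℝ) * t)) * Real.exp (-1) := by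
    rw [← Real.exp_add, Real.exp_le_exp]; nlinarith
  have h3 := exp_low 1 (by norm_num) le_rfl
  have h4 := Real.exp_pos (-((i.1 : ℝ) * t))
  nlinarith

theorem ev_rename {n : ℕ} (m : ℕ) (σ τ : Equiv.Perm (Fin n)) (f : MvPolynomial (Fin n) ℤ) :
    aeval (xx m σ) (rename (⇑τ) f) = aeval (xx m (σ * τ)) f := by
  rw [aeval_rename]; rfl

/-- polynomial growth bound -/
def Bd {n : ℕ} (f : ℕ → MvPolynomial (Fin n) ℤ) (s : ℕ) : Prop :=
  ∃ C : ℝ, ∀ m : ℕ, 1 ≤ m → ∀ σ : Equiv.Perm (Fin n), |aeval (xx m σ) (f m)| ≤ C * (m : ℝ) ^ s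

theorem Bd_mono {n : ℕ} {f : ℕ → MvPolynomial (Fin n) ℤ} {s t : ℕ} (h : Bd f s) (hst : s ≤ t) :
    Bd f t := by
  obtain ⟨C, hC⟩ := h
  refine ⟨|C|, fun m hm σ => (hC m hm σ).trans ?_⟩
  have hm' : (1 : ℝ) ≤ m := by exact_mod_cast hm
  exact mul_le_mul (le_abs_self _) (pow_le_pow_right₀ hm' hst) (by positivity) (abs_nonneg _)

theorem Bd_dem {n p : ℕ} (hp : p + 1 < n) {f : ℕ → MvPolynomial (Fin n) ℤ} {s : ℕ} (h : Bd f s) :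
    Bd (fun m => dem n (p + 1) (f m)) (s + 1) := by
  obtain ⟨C, hC⟩ := h
  set c : ℝ := Real.exp (-(n : ℝ)) / 2 with hc
  have hc0 : 0 < c := by positivity
  refine ⟨2 * C / c, fun m hm σ => ?_⟩
  have hm' : (0 : ℝ) < m := by exact_mod_cast hm
  have h1 := congrArg (aeval (xx m σ)) (dem_spec hp (f m))
  rw [map_mul, map_sub, map_sub, map_mul, map_mul, ev_rename, aeval_X, aeval_X] at h1
  have h2 := xx_low m hm σ ⟨p, by omega⟩ ⟨p + 1, hp⟩ (by simp)
  have h3 := hC m hm σ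
  have h4 := hC m hm (σ * Equiv.swap ⟨p, by omega⟩ ⟨p + 1, hp⟩)
  have ha := xx_mem m σ ⟨p, by omega⟩
  have hb := xx_mem m σ ⟨p + 1, hp⟩
  have h5 : |xx m σ ⟨p, by omega⟩ - xx m σ ⟨p + 1, hp⟩| *
      |aeval (xx m σ) (dem n (p + 1) (f m))| ≤ 2 * C * (m : ℝ) ^ s := by
    rw [← abs_mul, h1]
    refine (abs_sub _ _).trans ?_
    rw [abs_mul, abs_mul, abs_of_nonneg ha.1, abs_of_nonneg hb.1]
    have h6 := mul_le_of_le_one_left (abs_nonneg (aeval (xx m σ) (f m))) ha.2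
    have h7 := mul_le_of_le_one_left (abs_nonneg (aeval (xx m (σ * Equiv.swap ⟨p, by omega⟩ ⟨p + 1, hp⟩)) (f m))) hb.2
    linarith
  have h6 := mul_le_mul_of_nonneg_right h2 (abs_nonneg (aeval (xx m σ) (dem n (p + 1) (f m))))
  have h7 := h6.trans h5
  have h8 : |aeval (xx m σ) (dem n (p + 1) (f m))| =
      (c / m * |aeval (xx m σ) (dem n (p + 1) (f m))|) * (m / c) := by field_simp
  rw [h8]
  calc _ ≤ (2 * C * (m : ℝ) ^ s) * (m / c) := by
        apply mul_le_mul_of_nonneg_right h7 (by positivity)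
    _ = 2 * C / c * (m : ℝ) ^ (s + 1) := by ring

theorem Bd_div {n : ℕ} {f : ℕ → MvPolynomial (Fin n) ℤ} {s : ℕ} (S : Finset (Fin n × Fin n))
    (hS : ∀ q ∈ S, q.1 ≠ q.2) (h : Bd (fun m => f m * ∏ q ∈ S, (X q.1 - X q.2)) s) :
    Bd f (s + S.card) := by
  obtain ⟨C, hC⟩ := h
  set c : ℝ := Real.exp (-(n : ℝ)) / 2 with hc
  have hc0 : 0 < c := by positivity
  refine ⟨C / c ^ S.card, fun m hm σ => ?_⟩
  have hm' : (0 : ℝ) < m := by exact_mod_cast hm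
  have h1 := hC m hm σ
  simp only [map_mul, map_prod, map_sub, aeval_X, abs_mul, Finset.abs_prod] at h1
  have h2 : (c / m) ^ S.card ≤ ∏ q ∈ S, |xx m σ q.1 - xx m σ q.2| := by
    rw [← Finset.prod_const]
    exact Finset.prod_le_prod (fun _ _ => by positivity)
      (fun q hq => xx_low m hm σ _ _ (hS q hq))
  have h3 := (mul_le_mul_of_nonneg_left h2 (abs_nonneg (aeval (xx m σ) (f m)))).trans h1
  rw [div_pow] at h3
  calc |aeval (xx m σ) (f m)| =
      (|aeval (xx m σ) (f m)| * (c ^ S.card / (m : ℝ) ^ S.card)) *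
        ((m : ℝ) ^ S.card / c ^ S.card) := by field_simp
    _ ≤ (C * (m : ℝ) ^ s) * ((m : ℝ) ^ S.card / c ^ S.card) :=
        mul_le_mul_of_nonneg_right h3 (by positivity)
    _ = C / c ^ S.card * (m : ℝ) ^ (s + S.card) := by rw [pow_add]; ring

/-- the test partitions -/
def lamm (n m : ℕ) (j : Fin n) : ℕ := m * (n - 1 - j.1)

theorem lamm_part (n m : ℕ) : IsPartition n (lamm n m) := by
  intro i j hij
  have : i.1 ≤ j.1 := hij
  exact Nat.mul_le_mul_left _ (by omega)

theorem climb {n : ℕ} (N : ℕ) : ∀ (w : Equiv.Perm (Fin n)) (s : ℕ), ninv w ≤ N →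
    Bd (fun m => keyPoly n (pact n w (lamm n m))) s →
    ∃ w0 : Equiv.Perm (Fin n), (∀ i j, i < j → w0⁻¹ j < w0⁻¹ i) ∧
      Bd (fun m => keyPoly n (pact n w0 (lamm n m))) (s + ninv w) := by
  induction N with
  | zero =>
    intro w s hN hB
    refine ⟨w, ?_, Bd_mono hB (by omega)⟩
    intro i j hij
    have h0 : ninv w = 0 := by omega
    rw [ninv, Finset.card_eq_zero, Finset.filter_eq_empty_iff] at h0
    have := @h0 (i, j) (Finset.mem_univ _)
    simp only [not_and, not_lt] at this
    exact lt_of_le_of_ne (this hij) (fun e => hij.ne (w⁻¹.injective e).symm)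
  | succ N ih =>
    intro w s hN hB
    by_cases hex : ∃ p, ∃ hp : p + 1 < n, w⁻¹ ⟨p, by omega⟩ < w⁻¹ ⟨p + 1, hp⟩
    · obtain ⟨p, hp, hlt⟩ := hex
      have h1 := ninv_lt hp w hlt
      have h2 : Bd (fun m => keyPoly n (pact n (asw hp * w) (lamm n m))) (s + 1) := by
        have := Bd_dem hp hB
        have e : (fun m => keyPoly n (pact n (asw hp * w) (lamm n m))) =
            fun m => dem n (p + 1) (keyPoly n (pact n w (lamm n m))) := by
          funext m
          rw [pact_asw, key_up' hp]
          exact lamm_part n m _ _ hlt.le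
        rw [e]; exact this
      obtain ⟨w0, h3, h4⟩ := ih _ _ (by omega) h2
      exact ⟨w0, h3, Bd_mono h4 (by omega)⟩
    · refine ⟨w, ?_, Bd_mono hB (by omega)⟩
      intro i j hij
      push Not at hex
      refine adj_chain (fun i j : Fin n => w⁻¹ j < w⁻¹ i) (fun a b c h1 h2 => lt_trans h2 h1)
        i j.1 j.2 hij ?_
      intro p hp _ _
      refine lt_of_le_of_ne (hex p hp) fun e => ?_
      have := congrArg Fin.val (w⁻¹.injective e)
      simp at this

end LSS

open scoped Classical
set_option linter.unusedSimpArgs false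
set_option linter.unusedSectionVars false
namespace LSS
open MvPolynomial

theorem psum_lamm (n m : ℕ) : psum (lamm n m) n ≤ m * (n * n) := by
  have : ∀ j : Fin n, lamm n m j * (if j.1 < n then 1 else 0) ≤ m * n := by
    intro j
    rw [if_pos j.2, mul_one, lamm]
    exact Nat.mul_le_mul_left _ (by omega)
  refine (Finset.sum_le_card_nsmul _ _ (m * n) fun j _ => this j).trans ?_
  simp only [Finset.card_univ, Fintype.card_fin, smul_eq_mul]
  exact le_of_eq (by ring)

theorem ev_Alt_pow {n : ℕ} {τ : Type*} [LinearOrder τ] (b : Fin n → τ) (ρ : Fin n → ℕ) (N : ℕ)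
    (x : Fin n → ℝ) :
    aeval x (Alt b (mono n (fun j => N * ρ j))) =
      aeval (fun j => x j ^ N) (Alt b (mono n ρ)) := by
  simp only [Alt_apply, map_sum, map_zsmul]
  refine Finset.sum_congr rfl fun σ _ => ?_
  congr 1
  simp only [rename_mono, mono_prod, map_prod, map_pow, rename_X, aeval_X, Function.comp, pow_mul]

theorem no_bd {n : ℕ} (hn : 0 < n) (w0 : Equiv.Perm (Fin n))
    (h0 : ∀ i j, i < j → w0⁻¹ j < w0⁻¹ i) (s : ℕ)
    (hs : s < (Finset.univ.filter fun q : Fin n × Fin n => q.1 < q.2).card)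
    (hB : Bd (fun m => keyPoly n (pact n w0 (lamm n m))) s) : False := by
  obtain ⟨C, hC⟩ := hB
  set d : Fin (0 + 2) → ℕ := ![0, n] with hd_def
  have hd : BlockData n 0 d := by
    refine ⟨rfl, rfl, ?_⟩
    rw [Fin.strictMono_iff_lt_succ]
    intro i
    fin_cases i
    exact hn
  set b : Fin n → Fin (0 + 1) := fun _ => 0 with hb_def
  have hb : IsLab d b := fun j => ⟨Nat.zero_le _, j.2⟩
  have hprs : prs b = Finset.univ.filter fun q : Fin n × Fin n => q.1 < q.2 := by
    simp [prs, hb_def]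
  rw [← hprs] at hs
  have hrho : ∀ j, rho d b j = n - 1 - j.1 := fun j => rfl
  set N := (prs b).card with hN
  have hid : ∀ m : ℕ, keyPoly n (pact n w0 (lamm n m)) * ∏ q ∈ prs b, (X q.1 - X q.2) =
      Alt b (mono n (fun j => (m + 1) * rho d b j)) := by
    intro m
    rw [← delta_prod hd hb, key_delta b (lab_mono hd hb) (rho_isRho hb) w0⁻¹ w0 (fun _ => rfl)
      (fun i j h _ => h0 i j h) _ (lamm_part n m), inv_mul_cancel]
    have : pact n 1 (lamm n m) = lamm n m := rfl
    rw [this, keyPoly_dec _ (fun p hp => lamm_part n m _ _ (by simp [Fin.le_def])), mono_mul]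
    congr 2
    funext j
    simp only [Pi.add_apply, hrho, lamm]
    ring
  set c : ℝ := Real.exp (-(2 * n : ℝ)) / 2 with hc
  have hc0 : 0 < c := by positivity
  have key : ∀ m : ℕ, 1 ≤ m → c ^ N ≤ C * (m : ℝ) ^ s * ((n : ℝ) / m) ^ N := by
    intro m hm
    have h1 := congrArg (aeval (xx m (1 : Equiv.Perm (Fin n)))) (hid m)
    rw [ev_Alt_pow, delta_prod hd hb] at h1
    have h2 := congrArg abs h1
    simp only [map_mul, map_prod, map_sub, aeval_X, abs_mul, Finset.abs_prod] at h2
    have h3 : c ^ N ≤ ∏ q ∈ prs b,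
        |xx m (1 : Equiv.Perm (Fin n)) q.1 ^ (m + 1) - xx m 1 q.2 ^ (m + 1)| := by
      rw [hN, ← Finset.prod_const]
      refine Finset.prod_le_prod (fun _ _ => hc0.le) fun q hq => ?_
      rw [hprs] at hq
      exact xx_pow_low m hm _ _ (Finset.mem_filter.1 hq).2
    have h4 : ∏ q ∈ prs b, |xx m (1 : Equiv.Perm (Fin n)) q.1 - xx m 1 q.2| ≤
        ((n : ℝ) / m) ^ N := by
      rw [hN, ← Finset.prod_const]
      refine Finset.prod_le_prod (fun _ _ => abs_nonneg _) fun q hq => ?_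
      rw [hprs] at hq
      exact xx_up m hm _ _ (Finset.mem_filter.1 hq).2
    rw [← h2] at h3
    refine h3.trans ?_
    have h5 := hC m hm 1
    exact mul_le_mul h5 h4 (Finset.prod_nonneg fun _ _ => abs_nonneg _)
      ((abs_nonneg _).trans h5)
  have hCn : 0 ≤ C := by
    have := (abs_nonneg _).trans (hC 1 le_rfl 1)
    simpa using this
  have key2 : ∀ m : ℕ, 1 ≤ m → c ^ N * m ≤ C * (n : ℝ) ^ N := by
    intro m hm
    have hm1 : (1 : ℝ) ≤ m := by exact_mod_cast hm
    have hm0 : (0 : ℝ) < m := by linarith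
    have h1 := key m hm
    rw [div_pow (n : ℝ) (m : ℝ)] at h1
    have h2 : (m : ℝ) ^ (s + 1) ≤ (m : ℝ) ^ N := pow_le_pow_right₀ hm1 hs
    calc c ^ N * m ≤ C * (m : ℝ) ^ s * ((n : ℝ) ^ N / (m : ℝ) ^ N) * m :=
          mul_le_mul_of_nonneg_right h1 hm0.le
      _ = C * (n : ℝ) ^ N * ((m : ℝ) ^ (s + 1) / (m : ℝ) ^ N) := by rw [pow_succ]; ring
      _ ≤ C * (n : ℝ) ^ N * 1 := by
          apply mul_le_mul_of_nonneg_left _ (by positivity)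
          rw [div_le_one (by positivity)]; exact h2
      _ = _ := mul_one _
  have hcN : 0 < c ^ N := by positivity
  obtain ⟨m, hm⟩ := exists_nat_gt (C * (n : ℝ) ^ N / c ^ N)
  rw [div_lt_iff₀ hcN] at hm
  have h1 := key2 (m + 1) (by omega)
  push_cast at h1
  nlinarith

theorem backward {n k : ℕ} {d : Fin (k + 2) → ℕ} {b : Fin n → Fin (k + 1)}
    (hd : BlockData n k d) (hb : IsLab d b) (u w : Equiv.Perm (Fin n))
    (hub : ∀ i, b (u i) = b i) (hu : ∀ i j, i < j → b i = b j → u j < u i)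
    (hw : ∀ i j, i < j → b i = b j → w⁻¹ j < w⁻¹ i)
    (H : ∀ lam : Fin n → ℕ, IsPartition n lam →
        ∃ T : Finset (Fin (k + 1) → ℕ → ℕ), (∀ γ ∈ T, ParD k d γ) ∧
          keyPoly n (pact n w lam) = ∑ γ ∈ T, dSchur n k d γ) : IsStdCox n (u * w) := by
  have hbm := lab_mono hd hb
  have hn : 0 < n := by
    have := hd.2.2 (Fin.last_pos : (0 : Fin (k + 2)) < Fin.last (k + 1))
    rw [hd.1, hd.2.1] at this; exact this
  obtain ⟨L, hL, hprod, hlen, -, hkey⟩ := exists_word b hbm _ (u * w) le_rfl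
  by_cases hnd : L.Nodup
  · exact ⟨L, hnd, hL, hprod⟩
  exfalso
  set r := L.toFinset.card with hr
  have hrl : r < L.length := by
    refine lt_of_le_of_ne (List.toFinset_card_le L) fun e => hnd ?_
    exact Multiset.coe_nodup.1 (Multiset.toFinset_card_eq_card_iff_nodup.1 e)
  have hBG : Bd (fun m => keyPoly n (pact n w (lamm n m)) *
      ∏ q ∈ prs b, (X q.1 - X q.2)) r := by
    refine ⟨(n.factorial : ℝ) * ((n : ℝ) * n + 1) ^ r, fun m hm σ => ?_⟩
    obtain ⟨T, hT, hk⟩ := H _ (lamm_part n m)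
    refine (G_bound hd hb u w hub hw _ (lamm_part n m) T hT hk _ (xx_mem m σ)).trans ?_
    rw [hkey _ (lamm_part n m), mul_assoc, ← mul_pow]
    have h1 : (demWord n L (mono n (lamm n m))).support.card ≤ ((n * n + 1) * m) ^ r := by
      refine (supp_card L hL _).trans (Nat.pow_le_pow_left ?_ _)
      have := psum_lamm n m
      nlinarith
    have h2 := Nat.mul_le_mul_left n.factorial h1
    exact_mod_cast h2
  have hB1 := Bd_div (prs b) (fun q hq => (Finset.mem_filter.1 hq).2.1.ne) hBG
  obtain ⟨w0, hw0, hB2⟩ := climb _ w _ le_rfl hB1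
  have hcount := count b hbm u w hub hu hw
  exact no_bd hn w0 hw0 _ (by omega) hB2

end LSS

namespace LSS

/-- Theorem 1.6 / Theorem 4.9: `w_0(I)·w` is a standard Coxeter element
of some parabolic subgroup iff for every partition `λ`, the key polynomial `κ_{wλ}` is
`D`-multiplicity-free, i.e. it is a sum of pairwise distinct `D`-Schur polynomials. -/
theorem stmt1 (n k : ℕ) (d : Fin (k + 2) → ℕ) (hd : BlockData n k d)
    (w : Equiv.Perm (Fin n)) (I : Set ℕ) (hI : I ⊆ Descents n w)
    (hID : ∀ m, m ∈ I ↔ (1 ≤ m ∧ m ≤ n - 1 ∧ m ∉ Dset k d))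
    (w0I : Equiv.Perm (Fin n)) (h0 : IsLongest n I w0I) :
    IsStdCox n (w0I * w) ↔
      ∀ lam : Fin n → ℕ, IsPartition n lam →
        ∃ T : Finset (Fin (k + 1) → ℕ → ℕ), (∀ γ ∈ T, ParD k d γ) ∧
          keyPoly n (pact n w lam) = ∑ γ ∈ T, dSchur n k d γ := by
  obtain ⟨b, hb⟩ := exists_lab hd
  have hbm := lab_mono hd hb
  have hIb := lab_I hd hb I hID
  have hv := parab_block b I (fun m hm => ⟨((hID m).1 hm).1, ((hID m).1 hm).2.1⟩) hIb w0I h0.1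
  have hu := longest_anti b hbm I hIb w0I h0
  have hw := desc_anti b hbm I hIb w hI
  exact ⟨fun hc lam hl => forward hd hb I hIb w0I w hv hw hc lam hl,
    fun H => backward hd hb w0I w hv hu hw H⟩

end LSS
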